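/- arXiv:2509.21929 — 11 statements merged into one kernel-verified Lean document; each statement's English description precedes it below -/
import Mathlib

section
/- (Proposition 6.1, verification part.) Let $0<r<\mu$, $\sigma>0$, $\delta>0$, $0<S<R<1$, $\nu=(1-R)/(1-S)\in(0,1)$, $\rho=1-1/\nu$, $\kappa=(\mu-r)^{2}/(2\sigma^{2})$, assume $\eta=\frac{1}{S}[\delta+(S-1)(r+\kappa/R)]>0$, and let $0<k<\frac{\mu-r}{R\sigma^{2}}$. Set $\eta^{0}=\frac{S-1}{S}\left[k(\mu-r)-\tfrac{1}{2}\sigma^{2}Rk^{2}+r-\frac{\delta\nu}{1-R}\right]$ (so $\eta^0>0$) and $J^{0}(x)=(\eta^{0})^{-\nu S}\frac{x^{1-R}}{1-R}$. Then $J^{0}$ is a $C^{2}$ solution on $(0,\infty)$ of the HJB equation with proportional leverage bound $g(x)=kx$: for every $x>0$, $\delta\nu J^{0}(x)=\sup_{|\pi|\le kx}\left[\pi(\mu-r)J^{0\prime}(x)+\tfrac{1}{2}\sigma^{2}\pi^{2}J^{0\prime\prime}(x)\right]+\sup_{c\ge 0}\left[f(c,J^{0}(x))-cJ^{0\prime}(x)\right]+rxJ^{0\prime}(x)$,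 and the two suprema are attained at $\pi=kx$ and $c=\eta^{0}x$, respectively. -/
set_option autoImplicit false
open Real Set

/-- The map `c ↦ a * (c ^ (1 - S) / (1 - S) * m ^ S) - c * a` is maximised over `c ≥ 0` at `m`. -/
theorem rpow_div_mul_sub_mul_le {S a m c : ℝ} (hS : 0 < S) (hS1 : S < 1) (ha : 0 < a)
    (hm : 0 < m) (hc : 0 ≤ c) :
    a * (c ^ (1 - S) / (1 - S) * m ^ S) - c * a ≤ a * (m * (S / (1 - S))) := by
  obtain ⟨t, ht, rfl⟩ : ∃ t : ℝ, 0 ≤ t ∧ c = t * m :=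
    ⟨c / m, by positivity, by field_simp⟩
  have hmm : m ^ (1 - S) * m ^ S = m := by
    rw [← rpow_add hm, sub_add_cancel, rpow_one]
  have hb : t ^ (1 - S) ≤ 1 + (1 - S) * (t - 1) := by
    simpa using rpow_one_add_le_one_add_mul_self (s := t - 1) (by linarith)
      (p := 1 - S) (by linarith) (by linarith)
  have h1S : 0 < 1 - S := by linarith
  have hdiv : t ^ (1 - S) / (1 - S) ≤ t + S / (1 - S) := by
    rw [div_le_iff₀ h1S, add_mul, div_mul_cancel₀ _ h1S.ne']
    linarith
  rw [mul_rpow ht hm.le]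
  calc a * (t ^ (1 - S) * m ^ (1 - S) / (1 - S) * m ^ S) - t * m * a
      = a * (t ^ (1 - S) / (1 - S) * (m ^ (1 - S) * m ^ S)) - t * m * a := by ring
    _ = a * m * (t ^ (1 - S) / (1 - S) - t) := by rw [hmm]; ring
    _ ≤ a * m * (S / (1 - S)) := by gcongr; linarith
    _ = a * (m * (S / (1 - S))) := by ring

/-- A constant-elasticity function `A * (x ^ (1 - R) / (1 - R))` has derivative `A * x ^ (-R)`. -/
theorem hasDerivAt_mul_rpow_one_sub_div {A R x : ℝ} (hR : R < 1) (hx : 0 < x) :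
    HasDerivAt (fun y : ℝ => A * (y ^ (1 - R) / (1 - R))) (A * x ^ (-R)) x := by
  have h1R : 1 - R ≠ 0 := by linarith
  refine (((hasDerivAt_rpow_const (p := 1 - R) (Or.inl hx.ne')).div_const (1 - R)).const_mul
    A).congr_deriv ?_
  rw [mul_div_cancel_left₀ _ h1R, show 1 - R - 1 = -R by ring]

/-- On `|p| ≤ k * x` the concave quadratic `p * b - s * p ^ 2 / (2 * x)` is maximised at `k * x`
when its slope there is nonnegative. -/
theorem mul_sub_sq_div_le {b s k x p : ℝ} (hs : 0 ≤ s) (hx : 0 < x) (hk : s * k ≤ b)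
    (hp : p ≤ k * x) :
    p * b - s * p ^ 2 / (2 * x) ≤ x * (k * b - s * k ^ 2 / 2) := by
  obtain ⟨q, rfl⟩ : ∃ q : ℝ, p = q * x := ⟨p / x, by field_simp⟩
  have hq : q ≤ k := le_of_mul_le_mul_right hp hx
  have key : q * b - s * q ^ 2 / 2 ≤ k * b - s * k ^ 2 / 2 := by
    nlinarith [mul_nonneg (sub_nonneg.2 hq) (sub_nonneg.2 hk), mul_nonneg hs (sq_nonneg (k - q))]
  calc q * x * b - s * (q * x) ^ 2 / (2 * x) = x * (q * b - s * q ^ 2 / 2) := by field_simp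
    _ ≤ _ := by gcongr

/-- Proposition 6.1, verification part: with proportional leverage bound
`g(x) = kx`, the function `J⁰(x) = (η⁰)^(-νS) x^(1-R)/(1-R)` is a `C²` solution of the
HJB equation on `(0,∞)`, and the two suprema in the Hamiltonian are attained at
`π = kx` and `c = η⁰ x` respectively. -/
theorem proportional_leverage_verification
    (μ r σ δ R S ν ρ κ η k η0 : ℝ)
    (hr : 0 < r) (hrμ : r < μ) (hσ : 0 < σ) (hδ : 0 < δ)
    (hS : 0 < S) (hSR : S < R) (hR : R < 1)
    (hν : ν = (1 - R) / (1 - S)) (hν0 : 0 < ν) (hν1 : ν < 1)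
    (hρ : ρ = 1 - 1 / ν)
    (hκ : κ = (μ - r) ^ 2 / (2 * σ ^ 2))
    (hη : η = (1 / S) * (δ + (S - 1) * (r + κ / R))) (hηpos : 0 < η)
    (hk0 : 0 < k) (hk : k < (μ - r) / (R * σ ^ 2))
    (hη0 : η0 = (S - 1) / S *
      (k * (μ - r) - σ ^ 2 * R * k ^ 2 / 2 + r - δ * ν / (1 - R)))
    (f : ℝ → ℝ → ℝ)
    (hf : ∀ c v : ℝ, f c v = c ^ (1 - S) / (1 - S) * ((1 - R) * v) ^ ρ)
    (J0 : ℝ → ℝ)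
    (hJ0 : ∀ x : ℝ, J0 x = η0 ^ (-(ν * S)) * (x ^ (1 - R) / (1 - R))) :
    0 < η0 ∧
    ContDiffOn ℝ 2 J0 (Ioi 0) ∧
    ∃ J0' J0'' : ℝ → ℝ,
      (∀ x ∈ Ioi (0 : ℝ), HasDerivAt J0 (J0' x) x) ∧
      (∀ x ∈ Ioi (0 : ℝ), HasDerivAt J0' (J0'' x) x) ∧
      ∀ x > (0 : ℝ),
        IsGreatest
          {y | ∃ pp : ℝ, |pp| ≤ k * x ∧
            y = pp * (μ - r) * J0' x + σ ^ 2 * pp ^ 2 * J0'' x / 2}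
          (k * x * (μ - r) * J0' x + σ ^ 2 * (k * x) ^ 2 * J0'' x / 2) ∧
        IsGreatest
          {y | ∃ c : ℝ, 0 ≤ c ∧ y = f c (J0 x) - c * J0' x}
          (f (η0 * x) (J0 x) - η0 * x * J0' x) ∧
        δ * ν * J0 x =
          (k * x * (μ - r) * J0' x + σ ^ 2 * (k * x) ^ 2 * J0'' x / 2) +
          (f (η0 * x) (J0 x) - η0 * x * J0' x) + r * x * J0' x := by
  have h1S : 0 < 1 - S := by linarith
  have h1R : 0 < 1 - R := by linarith
  have hR0 : 0 < R := by linarith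
  have hσR : 0 < R * σ ^ 2 := by positivity
  have hkb : σ ^ 2 * R * k < μ - r := by
    rw [lt_div_iff₀ hσR] at hk
    linarith
  have hνR : δ * ν / (1 - R) = δ / (1 - S) := by
    rw [hν]; field_simp
  have hκR : k * (μ - r) - σ ^ 2 * R * k ^ 2 / 2 ≤ κ / R := by
    have h : κ / R - (k * (μ - r) - σ ^ 2 * R * k ^ 2 / 2)
        = (μ - r - σ ^ 2 * R * k) ^ 2 / (2 * σ ^ 2 * R) := by
      rw [hκ]; field_simp; ring
    have : 0 ≤ (μ - r - σ ^ 2 * R * k) ^ 2 / (2 * σ ^ 2 * R) := by positivity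
    linarith
  have hη0pos : 0 < η0 := by
    have h : η0 = η + (1 - S) / S * (κ / R - (k * (μ - r) - σ ^ 2 * R * k ^ 2 / 2)) := by
      rw [hη0, hη, hνR]; field_simp; ring
    have : 0 ≤ (1 - S) / S * (κ / R - (k * (μ - r) - σ ^ 2 * R * k ^ 2 / 2)) :=
      mul_nonneg (by positivity) (by linarith)
    linarith
  have hη0eq : δ * ν / (1 - R)
      = k * (μ - r) - σ ^ 2 * R * k ^ 2 / 2 + r + η0 * (S / (1 - S)) := by
    rw [hη0]; field_simp; ring
  have hνρ : -(ν * S) * ρ = -(ν * S) + S := by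
    rw [hρ]; field_simp; ring
  have hRρ : (1 - R) * ρ = S - R := by
    rw [hρ, hν]; field_simp; ring
  obtain rfl : J0 = fun y : ℝ => η0 ^ (-(ν * S)) * (y ^ (1 - R) / (1 - R)) := funext hJ0
  set A : ℝ := η0 ^ (-(ν * S)) with hA
  have hApos : 0 < A := rpow_pos_of_pos hη0pos _
  have hAρ : A ^ ρ = A * η0 ^ S := by
    rw [hA, ← rpow_mul hη0pos.le, hνρ, rpow_add hη0pos]
  refine ⟨hη0pos, ?_, fun x => A * x ^ (-R), fun x => A * (-R * x ^ (-R - 1)),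
    fun x hx => hasDerivAt_mul_rpow_one_sub_div hR hx,
    fun x hx => (hasDerivAt_rpow_const (Or.inl (ne_of_gt hx))).const_mul A, ?_⟩
  · exact contDiffOn_const.mul
      ((contDiffOn_id.rpow_const_of_ne fun x hx => ne_of_gt hx).div_const _)
  intro x hx
  have ha : 0 < A * x ^ (-R) := by positivity
  have hx2 : x ^ (-R - 1) = x ^ (-R) / x := rpow_sub_one hx.ne' _
  have hx1 : x ^ (1 - R) = x ^ (-R) * x := by
    rw [show 1 - R = -R + 1 by ring, rpow_add_one hx.ne']
  have hfJ : ∀ c : ℝ, f c (A * (x ^ (1 - R) / (1 - R)))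
      = A * x ^ (-R) * (c ^ (1 - S) / (1 - S) * (η0 * x) ^ S) := by
    intro c
    rw [hf, show (1 - R) * (A * (x ^ (1 - R) / (1 - R))) = A * x ^ (1 - R) by field_simp,
      mul_rpow hApos.le (by positivity), ← rpow_mul hx.le, hRρ, hAρ, mul_rpow hη0pos.le hx.le,
      sub_eq_add_neg S R, rpow_add hx]
    ring
  have hport : ∀ p : ℝ, p * (μ - r) * (A * x ^ (-R)) +
      σ ^ 2 * p ^ 2 * (A * (-R * x ^ (-R - 1))) / 2
      = A * x ^ (-R) * (p * (μ - r) - σ ^ 2 * R * p ^ 2 / (2 * x)) := by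
    intro p
    rw [hx2]; field_simp; ring
  have hport_max : k * x * (μ - r) - σ ^ 2 * R * (k * x) ^ 2 / (2 * x)
      = x * (k * (μ - r) - σ ^ 2 * R * k ^ 2 / 2) := by
    field_simp
  have hcons_max : A * x ^ (-R) * ((η0 * x) ^ (1 - S) / (1 - S) * (η0 * x) ^ S)
      - η0 * x * (A * x ^ (-R)) = A * x ^ (-R) * (η0 * x * (S / (1 - S))) := by
    have hmm : (η0 * x) ^ (1 - S) * (η0 * x) ^ S = η0 * x := by
      rw [← rpow_add (by positivity), sub_add_cancel, rpow_one]
    rw [div_mul_eq_mul_div, hmm]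
    field_simp; ring
  simp only [hfJ, hport, hport_max, hcons_max]
  refine ⟨⟨⟨k * x, (abs_of_pos (by positivity)).le, by rw [hport_max]⟩, ?_⟩,
    ⟨⟨η0 * x, by positivity, hcons_max.symm⟩, ?_⟩, ?_⟩
  · rintro _ ⟨p, hp, rfl⟩
    exact mul_le_mul_of_nonneg_left
      (mul_sub_sq_div_le (by positivity) hx hkb.le (le_of_abs_le hp)) ha.le
  · rintro _ ⟨c, hc, rfl⟩
    exact rpow_div_mul_sub_mul_le hS (by linarith) ha (by positivity) hc
  · rw [hx1]
    linear_combination A * x ^ (-R) * x * hη0eq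
end

section
/- (Corollary 6.2.) Let $0<r<\mu$, $\sigma>0$, $\delta>0$, $0<S<R<1$, $\nu=(1-R)/(1-S)\in(0,1)$, $\kappa=(\mu-r)^2/(2\sigma^2)$, assume $\eta=\frac{1}{S}[\delta+(S-1)(r+\kappa/R)]>0$, and let $0<k<\frac{\mu-r}{R\sigma^{2}}$. With $\eta^{0}=\frac{S-1}{S}[k(\mu-r)-\tfrac{1}{2}\sigma^{2}Rk^{2}+r-\frac{\delta\nu}{1-R}]$ and $J^{0}(x)=(\eta^{0})^{-\nu S}\frac{x^{1-R}}{1-R}$, the following hold for every $x>0$: (i) the optimal constrained investment satisfies $\pi^{0}(x)=kx<\frac{\mu-r}{R\sigma^{2}}x=\pi^{ez}(x)$; (ii) the optimal constrained consumption satisfies $c^{0}(x)=\eta^{0}x>\eta x=c^{ez}(x)$; (iii) the unconstrained Merton ratio of $J^{0}$ exceeds the bound everywhere, i.e. $-\frac{\mu-r}{\sigma^{2}}\frac{J^{0\prime}(x)}{J^{0\prime\prime}(x)}=\frac{\mu-r}{R\sigma^{2}}x>kx$, so the constrained region is all of $(0,\infty)$. -/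
set_option autoImplicit false
open Real Set

/-- Left of its vertex, `k ↦ k m - v R k² / 2` is strictly below its maximal value. -/
theorem quadratic_growth_lt_max {m v R k : ℝ} (hR : 0 < R) (hv : 0 < v) (hk : k < m / (R * v)) :
    k * m - v * R * k ^ 2 / 2 < m ^ 2 / (2 * v) / R := by
  have hgap : 0 < m - k * (R * v) := sub_pos.2 ((lt_div_iff₀ (by positivity)).1 hk)
  have hsq : m ^ 2 / (2 * v) / R - (k * m - v * R * k ^ 2 / 2)
      = (m - k * (R * v)) ^ 2 / (2 * v * R) := by
    field_simp
    ring
  have : 0 < (m - k * (R * v)) ^ 2 / (2 * v * R) := by positivity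
  linarith

/-- For a power utility `C x ^ (1 - R) / (1 - R)`, the first derivative at `x` divided by the second
is `-(x / R)`. -/
theorem power_utility_deriv_ratio {C R x : ℝ} (hC : C ≠ 0) (hR0 : R ≠ 0) (hR1 : R ≠ 1)
    {J J' J'' : ℝ → ℝ} (hJ : ∀ x, J x = C * (x ^ (1 - R) / (1 - R)))
    (hd1 : ∀ x > (0 : ℝ), HasDerivAt J (J' x) x)
    (hd2 : ∀ x > (0 : ℝ), HasDerivAt J' (J'' x) x) (hx : 0 < x) :
    J' x / J'' x = -(x / R) := by
  have h1R : 1 - R ≠ 0 := sub_ne_zero.2 hR1.symm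
  have hJ' : ∀ y > (0 : ℝ), J' y = C * y ^ (-R) := by
    intro y hy
    have h := ((hasDerivAt_rpow_const (p := 1 - R) (Or.inl hy.ne')).div_const (1 - R)).const_mul C
    rw [(hd1 y hy).unique (h.congr_of_eventuallyEq (Filter.Eventually.of_forall hJ)),
      mul_div_cancel_left₀ _ h1R, show 1 - R - 1 = -R by ring]
  have hJ'' : J'' x = C * (-R * x ^ (-R - 1)) := by
    have h := (hasDerivAt_rpow_const (p := -R) (Or.inl hx.ne')).const_mul C
    exact (hd2 x hx).unique (h.congr_of_eventuallyEq
      (Filter.eventually_of_mem (Ioi_mem_nhds hx) hJ'))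
  have hpow : x ^ (-R) ≠ 0 := (rpow_pos_of_pos hx _).ne'
  rw [hJ' x hx, hJ'', rpow_sub_one hx.ne']
  field_simp

/-- Corollary 6.2: under the proportional leverage bound `g(x) = kx` with
`0 < k < (μ-r)/(Rσ²)`, for every `x > 0`:
(i) the constrained investment `kx` is smaller than the unconstrained `π^{ez}(x)`;
(ii) the constrained consumption `η⁰x` exceeds the unconstrained `ηx`;
(iii) the Merton ratio of `J⁰` equals `(μ-r)/(Rσ²)x` and exceeds `kx`, so the
constrained region is all of `(0,∞)`. -/
theorem proportional_leverage_comparison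
    (μ r σ δ R S ν κ η k η0 : ℝ)
    (hr : 0 < r) (hrμ : r < μ) (hσ : 0 < σ) (hδ : 0 < δ)
    (hS : 0 < S) (hSR : S < R) (hR : R < 1)
    (hν : ν = (1 - R) / (1 - S)) (hν0 : 0 < ν) (hν1 : ν < 1)
    (hκ : κ = (μ - r) ^ 2 / (2 * σ ^ 2))
    (hη : η = (1 / S) * (δ + (S - 1) * (r + κ / R))) (hηpos : 0 < η)
    (hk0 : 0 < k) (hk : k < (μ - r) / (R * σ ^ 2))
    (hη0 : η0 = (S - 1) / S *
      (k * (μ - r) - σ ^ 2 * R * k ^ 2 / 2 + r - δ * ν / (1 - R)))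
    (J0 J0' J0'' : ℝ → ℝ)
    (hJ0 : ∀ x : ℝ, J0 x = η0 ^ (-(ν * S)) * (x ^ (1 - R) / (1 - R)))
    (hd1 : ∀ x > (0 : ℝ), HasDerivAt J0 (J0' x) x)
    (hd2 : ∀ x > (0 : ℝ), HasDerivAt J0' (J0'' x) x) :
    ∀ x > (0 : ℝ),
      (k * x < (μ - r) / (R * σ ^ 2) * x) ∧
      (η * x < η0 * x) ∧
      (-((μ - r) / σ ^ 2) * (J0' x / J0'' x) = (μ - r) / (R * σ ^ 2) * x ∧
        k * x < -((μ - r) / σ ^ 2) * (J0' x / J0'' x)) := by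
  have hR0 : 0 < R := hS.trans hSR
  have hηlt : η < η0 := by
    have hgrowth := quadratic_growth_lt_max hR0 (pow_pos hσ 2) hk
    rw [← hκ] at hgrowth
    have h1R : 1 - R ≠ 0 := by linarith
    have h1S : 0 < 1 - S := by linarith
    have hdiff : η0 - η
        = (1 - S) / S * (κ / R - (k * (μ - r) - σ ^ 2 * R * k ^ 2 / 2)) := by
      have hδν : δ * ν / (1 - R) = δ / (1 - S) := by
        rw [hν]
        field_simp
      rw [hη0, hη, hδν]
      field_simp
      ring
    have := mul_pos (div_pos h1S hS) (sub_pos.2 hgrowth)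
    linarith
  intro x hx
  have hkx : k * x < (μ - r) / (R * σ ^ 2) * x := mul_lt_mul_of_pos_right hk hx
  have hmerton : -((μ - r) / σ ^ 2) * (J0' x / J0'' x) = (μ - r) / (R * σ ^ 2) * x := by
    rw [power_utility_deriv_ratio (rpow_pos_of_pos (hηpos.trans hηlt) _).ne' hR0.ne' hR.ne
      hJ0 hd1 hd2 hx]
    field_simp
  exact ⟨hkx, mul_lt_mul_of_pos_right hηlt hx, hmerton, hmerton ▸ hkx⟩
end

section
/- (Theorem 6.5, deterministic form.) Let $\mu>0$, $\sigma>0$, $\delta>0$, $L>0$, $0<S<R<1$, $\nu=(1-R)/(1-S)\in(0,1)$, $\rho=1-1/\nu$, and take interest rate $r=0$. Let $J:(0,\infty)\to(0,\infty)$ be $C^{2}$ with $J'>0$ and $J''<0$, four times continuously differentiable on the open sets $\mathcal U=\{x>0:-\frac{\mu}{\sigma^{2}}\frac{J'(x)}{J''(x)}<L\}$ and $\mathcal B=\{x>0:-\frac{\mu}{\sigma^{2}}\frac{J'(x)}{J''(x)}>L\}$, satisfying for every $x>0$ the HJB equation $\delta\nu J(x)=\sup_{|\pi|\le L}\left[\pi\mu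 J'(x)+\tfrac12\sigma^{2}\pi^{2}J''(x)\right]+\frac{S}{1-S}((1-R)J(x))^{\rho/S}(J'(x))^{1-1/S}$, together with $\lim_{x\to 0^{+}}J(x)=0$ and $\lim_{x\to 0^{+}}J'(x)=+\infty$. Then there exists $x^{*}\in(0,\infty)$ such that $\mathcal U=(0,x^{*})$ and $\mathcal B=(x^{*},\infty)$. -/
open Real Set Filter

set_option autoImplicit false

/-- A function with positive derivative at `z` is below its value at `z` just to the left. -/
lemma HasDerivAt.eventually_lt_left {f : ℝ → ℝ} {f' z : ℝ} (h : HasDerivAt f f' z)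
    (hf' : 0 < f') : ∀ᶠ y in nhdsWithin z (Iio z), f y < f z := by
  have hs := (hasDerivAt_iff_tendsto_slope.1 h).eventually (lt_mem_nhds hf')
  filter_upwards [hs.filter_mono (nhdsWithin_mono z fun y (hy : y < z) => ne_of_lt hy),
    self_mem_nhdsWithin] with y hy hyz
  rw [slope_def_field, div_pos_iff] at hy
  have hyz' : y < z := hyz
  rcases hy with hy | hy <;> linarith [hy.1, hy.2]

/-- A function with negative derivative at `z` is below its value at `z` just to the right. -/
lemma HasDerivAt.eventually_lt_right {f : ℝ → ℝ} {f' z : ℝ} (h : HasDerivAt f f' z)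
    (hf' : f' < 0) : ∀ᶠ y in nhdsWithin z (Ioi z), f y < f z := by
  have hs := (hasDerivAt_iff_tendsto_slope.1 h).eventually (gt_mem_nhds hf')
  filter_upwards [hs.filter_mono (nhdsWithin_mono z fun y (hy : z < y) => ne_of_gt hy),
    self_mem_nhdsWithin] with y hy hyz
  rw [slope_def_field, div_neg_iff] at hy
  have hyz' : z < y := hyz
  rcases hy with hy | hy <;> linarith [hy.1, hy.2]

lemma le_of_hasDerivAt_nonneg {f f' : ℝ → ℝ} {a b : ℝ} (hab : a ≤ b)
    (hf : ∀ x, a ≤ x → x ≤ b → HasDerivAt f (f' x) x)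
    (hf' : ∀ x, a < x → x < b → 0 ≤ f' x) : f a ≤ f b := by
  refine monotoneOn_of_hasDerivWithinAt_nonneg (f' := f') (convex_Icc a b)
    (fun x hx => (hf x hx.1 hx.2).continuousAt.continuousWithinAt)
    (fun x hx => ?_) (fun x hx => ?_) (left_mem_Icc.2 hab) (right_mem_Icc.2 hab) hab
  all_goals rw [interior_Icc] at hx
  · exact (hf x hx.1.le hx.2.le).hasDerivWithinAt
  · exact hf' x hx.1 hx.2

/-- Solutions of `E' = h E` with `h ≥ 0` and `E a > 0` do not fall below `E a`. -/
lemma le_of_hasDerivAt_eq_mul_self {E h : ℝ → ℝ} {a b : ℝ} (hab : a ≤ b)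
    (hE : ∀ x, a ≤ x → x ≤ b → HasDerivAt E (h x * E x) x)
    (hh : ∀ x, a < x → x < b → 0 ≤ h x) (ha : 0 < E a) : E a ≤ E b := by
  have hsq : ∀ y, a ≤ y → y ≤ b → E a ^ 2 ≤ E y ^ 2 := fun y hay hyb =>
    le_of_hasDerivAt_nonneg (f := fun x => E x ^ 2) (f' := fun x => 2 * h x * E x ^ 2) hay
      (fun x hx hxy => by
        refine ((hE x hx (hxy.trans hyb)).fun_pow 2).congr_deriv ?_
        push_cast
        ring)
      (fun x hx hxy => by have := hh x hx (hxy.trans_le hyb); positivity)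
  have hcont : ContinuousOn E (Icc a b) := fun x hx =>
    (hE x hx.1 hx.2).continuousAt.continuousWithinAt
  have hb : 0 ≤ E b := by
    by_contra! hb
    obtain ⟨y, hy, hy0⟩ := intermediate_value_Icc' hab hcont ⟨hb.le, ha.le⟩
    have := hsq y hy.1 hy.2
    rw [hy0] at this
    nlinarith
  exact (pow_le_pow_iff_left₀ ha.le hb two_ne_zero).1 (hsq b hab le_rfl)

/-- The first-order system satisfied by `w = J' / J`, `q = -J'' / J'` and the ratio `β` of the
consumption term of the HJB equation to `δ ν J`. Here `F` is the optimal leverage term divided by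
`J'`, and the constraint binds when `q < k`, equivalently when `F > g`. -/
structure LeverageSystem (κ t d g k : ℝ) (w β q F : ℝ → ℝ) : Prop where
  hκ : 0 < κ
  ht : 0 < t
  hd : 0 < d
  hg : 0 < g
  hk : 0 < k
  w_pos : ∀ x > 0, 0 < w x
  β_pos : ∀ x > 0, 0 < β x
  q_pos : ∀ x > 0, 0 < q x
  F_eq : ∀ x > 0, F x = d * (1 - β x) / w x
  w_deriv : ∀ x > 0, HasDerivAt w (-(w x * (q x + w x))) x
  β_deriv : ∀ x > 0, HasDerivAt β (κ * β x * (q x - t * w x)) x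
  unconstrained : ∀ x > 0, k ≤ q x → q x * F x = k * g
  constrained : ∀ x > 0, q x ≤ k → F x = g * (2 - q x / k)

namespace LeverageSystem

variable {κ t d g k : ℝ} {w β q F : ℝ → ℝ}

lemma lt_iff (s : LeverageSystem κ t d g k w β q F) {x : ℝ} (hx : 0 < x) :
    F x < g ↔ k < q x := by
  have := s.hk
  have := s.hg
  constructor
  · intro h
    by_contra! hq
    have h1 := s.constrained x hx hq
    have h2 : q x / k ≤ 1 := (div_le_one s.hk).2 hq
    nlinarith
  · intro h
    have h1 := s.unconstrained x hx h.le
    by_contra! hF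
    nlinarith

lemma gt_iff (s : LeverageSystem κ t d g k w β q F) {x : ℝ} (hx : 0 < x) :
    g < F x ↔ q x < k := by
  have := s.hk
  have := s.hg
  constructor
  · intro h
    by_contra! hq
    have h1 := s.unconstrained x hx hq
    nlinarith
  · intro h
    have h1 := s.constrained x hx h.le
    have h2 : q x / k < 1 := (div_lt_one s.hk).2 h
    nlinarith

lemma F_pos (s : LeverageSystem κ t d g k w β q F) {x : ℝ} (hx : 0 < x) : 0 < F x := by
  rcases le_or_gt (F x) g with h | h
  · have hq : k ≤ q x := by
      by_contra! hq
      exact absurd ((s.gt_iff hx).2 hq) (not_lt.2 h)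
    have h1 := s.unconstrained x hx hq
    have h2 : 0 < q x * F x := h1 ▸ mul_pos s.hk s.hg
    exact (pos_iff_pos_of_mul_pos h2).1 (s.q_pos x hx)
  · exact s.hg.trans h

lemma β_lt_one (s : LeverageSystem κ t d g k w β q F) {x : ℝ} (hx : 0 < x) : β x < 1 := by
  have h := s.F_pos hx
  rw [s.F_eq x hx, div_pos_iff_of_pos_right (s.w_pos x hx), mul_pos_iff_of_pos_left s.hd] at h
  linarith

/-- On the closed unconstrained region `q` is a function of `w` and `β`. -/
lemma q_mul (s : LeverageSystem κ t d g k w β q F) {x : ℝ} (hx : 0 < x) (hF : F x ≤ g) :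
    q x * (1 - β x) = k * g / d * w x := by
  have hq : k ≤ q x := by
    by_contra! hq
    exact absurd ((s.gt_iff hx).2 hq) (not_lt.2 hF)
  have h1 := s.unconstrained x hx hq
  have := s.hd
  have := s.w_pos x hx
  rw [s.F_eq x hx] at h1
  field_simp at h1 ⊢
  linarith

lemma F_deriv (s : LeverageSystem κ t d g k w β q F) {x : ℝ} (hx : 0 < x) :
    HasDerivAt F (d / w x * ((1 - β x) * (q x + w x) - κ * β x * (q x - t * w x))) x := by
  have hw := s.w_pos x hx
  have h := (((s.β_deriv x hx).const_sub 1).const_mul d).fun_div (s.w_deriv x hx) hw.ne'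
  refine (h.congr_of_eventuallyEq ?_).congr_deriv ?_
  · filter_upwards [lt_mem_nhds hx] with y hy using s.F_eq y hy
  · field_simp
    ring

lemma continuousOn_F (s : LeverageSystem κ t d g k w β q F) : ContinuousOn F (Ioi 0) :=
  fun _ hx => (s.F_deriv hx).continuousAt.continuousWithinAt

/-- In the unconstrained region `β` satisfies an autonomous equation up to a positive factor. -/
lemma excess_deriv (s : LeverageSystem κ t d g k w β q F) {x : ℝ} (hx : 0 < x) (hF : F x ≤ g) :
    HasDerivAt (fun y => k * g / d - t * (1 - β y))
      (t * κ * β x * w x / (1 - β x) * (k * g / d - t * (1 - β x))) x := by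
  refine ((((s.β_deriv x hx).const_sub 1).const_mul t).const_sub (k * g / d)).congr_deriv ?_
  have h1 : (1 - β x) ≠ 0 := (sub_pos.2 (s.β_lt_one hx)).ne'
  have h2 := s.q_mul hx hF
  rw [div_mul_eq_mul_div, eq_div_iff h1]
  linear_combination t * κ * β x * h2

lemma β_le (s : LeverageSystem κ t d g k w β q F) {a b : ℝ} (ha : 0 < a) (hab : a ≤ b)
    (hF : ∀ x, a ≤ x → x ≤ b → F x ≤ g) (hE : 0 < k * g / d - t * (1 - β a)) :
    β a ≤ β b := by
  have h := le_of_hasDerivAt_eq_mul_self hab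
    (fun x hx hxb => s.excess_deriv (ha.trans_le hx) (hF x hx hxb)) (fun x hx _ => ?_) hE
  · have := s.ht
    nlinarith
  · have hx0 := ha.trans hx
    have := s.ht
    have := s.hκ
    have := s.β_pos x hx0
    have := s.w_pos x hx0
    have := sub_pos.2 (s.β_lt_one hx0)
    positivity

/-- Once the excess `k g / d - t (1 - β)` is positive, the unconstrained region cannot extend
to infinity. -/
lemma not_forall_lt_of_excess_pos (s : LeverageSystem κ t d g k w β q F) {a : ℝ} (ha : 0 < a)
    (hF : ∀ x, a ≤ x → F x < g) (hE : 0 < k * g / d - t * (1 - β a)) : False := by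
  have hκ := s.hκ
  have ht := s.ht
  have hM : 0 < k * g / d := div_pos (mul_pos s.hk s.hg) s.hd
  have hβa := sub_pos.2 (s.β_lt_one ha)
  set η := k * g / d / (1 - β a) - t with hη
  have hη0 : 0 < η := by
    rw [hη, sub_pos, lt_div_iff₀ hβa]
    linarith
  have hq : ∀ x, a ≤ x → (t + η) * w x ≤ q x := fun x hx => by
    have hx0 := ha.trans_le hx
    have h1 := s.q_mul hx0 (hF x hx).le
    have h2 := s.β_le ha hx (fun y hy _ => (hF y hy).le) hE
    have h3 := sub_pos.2 (s.β_lt_one hx0)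
    have h4 := s.w_pos x hx0
    have h5 : q x = k * g / d / (1 - β x) * w x := by
      field_simp at h1 ⊢
      linarith
    rw [h5, hη]
    gcongr
    rw [add_sub_cancel]
    gcongr
  have hlogβ : ∀ x, a ≤ x → HasDerivAt (fun y => log (β y)) (κ * (q x - t * w x)) x :=
    fun x hx => by
      have hx0 := ha.trans_le hx
      have h1 := s.β_pos x hx0
      refine ((s.β_deriv x hx0).log h1.ne').congr_deriv ?_
      field_simp
  have hlogw : ∀ x, a ≤ x → HasDerivAt (fun y => log (w y)) (-(q x + w x)) x :=
    fun x hx => by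
      have hx0 := ha.trans_le hx
      have h1 := s.w_pos x hx0
      refine ((s.w_deriv x hx0).log h1.ne').congr_deriv ?_
      field_simp
  have hβneg : ∀ x, a ≤ x → log (β x) < 0 := fun x hx =>
    log_neg (s.β_pos x (ha.trans_le hx)) (s.β_lt_one (ha.trans_le hx))
  set N := (1 + t + η) / η with hN
  have hN1 : 1 < N := by rw [hN, one_lt_div hη0]; linarith
  have hNη : N * η = 1 + t + η := by rw [hN]; field_simp
  set c := N / κ * log (β a) + log (w a) with hc
  have hwc : ∀ x, a ≤ x → exp c ≤ w x := fun x hx => by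
    have h := le_of_hasDerivAt_nonneg (f := fun y => N / κ * log (β y) + log (w y)) hx
      (fun y hy _ => ((hlogβ y hy).const_mul (N / κ)).fun_add (hlogw y hy)) (fun y hy _ => by
        have h1 := hq y hy.le
        have h2 : N / κ * (κ * (q y - t * w y)) = N * (q y - t * w y) := by field_simp
        rw [h2]
        have h3 : (N - 1) * ((t + η) * w y) ≤ (N - 1) * q y :=
          mul_le_mul_of_nonneg_left h1 (by linarith)
        linear_combination h3 - w y * hNη)
    rw [← le_log_iff_exp_le (s.w_pos x (ha.trans_le hx))]
    have h1 : N / κ * log (β x) < 0 :=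
      mul_neg_of_pos_of_neg (div_pos (by linarith) hκ) (hβneg x hx)
    linarith
  set r := κ * η * exp c with hr
  have hr0 : 0 < r := by positivity
  have hgrow : ∀ x, a ≤ x → log (β a) - r * a ≤ log (β x) - r * x := fun x hx =>
    le_of_hasDerivAt_nonneg (f := fun y => log (β y) - r * y) hx
      (fun y hy _ => (hlogβ y hy).fun_sub ((hasDerivAt_id y).const_mul r)) (fun y hy _ => by
        have h1 := hq y hy.le
        have h2 : η * exp c ≤ η * w y := mul_le_mul_of_nonneg_left (hwc y hy.le) hη0.le
        have h3 : κ * (η * exp c) ≤ κ * (q y - t * w y) :=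
          mul_le_mul_of_nonneg_left (by linarith) hκ.le
        rw [hr]
        linarith)
  have hlast : a ≤ a - log (β a) / r := by
    have := div_neg_of_neg_of_pos (hβneg a le_rfl) hr0
    linarith
  have h1 := hgrow _ hlast
  have h2 := hβneg _ hlast
  have h3 : r * (a - log (β a) / r) = r * a - log (β a) := by field_simp
  linarith

/-- The unconstrained region is bounded away from infinity. -/
lemma not_forall_lt (s : LeverageSystem κ t d g k w β q F) {a : ℝ} (ha : 0 < a)
    (hF : ∀ x, a ≤ x → F x < g) : False := by
  by_cases hE : ∃ b, a ≤ b ∧ 0 < k * g / d - t * (1 - β b)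
  · obtain ⟨b, hab, hb⟩ := hE
    exact s.not_forall_lt_of_excess_pos (ha.trans_le hab) (fun x hx => hF x (hab.trans hx)) hb
  push Not at hE
  have hκ := s.hκ
  have hd := s.hd
  have hq : ∀ x, a ≤ x → q x - t * w x ≤ 0 := fun x hx => by
    have hx0 := ha.trans_le hx
    have h1 := s.q_mul hx0 (hF x hx).le
    have h2 := sub_pos.2 (s.β_lt_one hx0)
    have h3 := mul_nonpos_of_nonneg_of_nonpos (s.w_pos x hx0).le (hE x hx)
    refine nonpos_of_mul_nonpos_left (b := 1 - β x) ?_ h2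
    linear_combination h3 + h1
  have hβ : ∀ x, a ≤ x → β x ≤ β a := fun x hx => by
    have h := le_of_hasDerivAt_nonneg (f := fun y => -β y) hx
      (fun y hy _ => (s.β_deriv y (ha.trans_le hy)).fun_neg) (fun y hy _ => by
        have := mul_nonneg_of_nonpos_of_nonpos
          (neg_nonpos.2 (mul_pos hκ (s.β_pos y (ha.trans hy))).le) (hq y hy.le)
        linarith)
    simpa using h
  have hβa := sub_pos.2 (s.β_lt_one ha)
  set r := d * (1 - β a) with hr
  have hr0 : 0 < r := mul_pos hd hβa
  have hgrow : ∀ x, a ≤ x → F a - r * a ≤ F x - r * x := fun x hx =>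
    le_of_hasDerivAt_nonneg (f := fun y => F y - r * y) hx
      (fun y hy _ => (s.F_deriv (ha.trans_le hy)).fun_sub ((hasDerivAt_id y).const_mul r))
      (fun y hy _ => by
        have hy0 := ha.trans hy
        have hw := s.w_pos y hy0
        have h1 := mul_nonneg_of_nonpos_of_nonpos
          (neg_nonpos.2 (mul_pos hκ (s.β_pos y hy0)).le) (hq y hy.le)
        have h2 := hβ y hy.le
        have h3 := mul_pos (sub_pos.2 (s.β_lt_one hy0)) (s.q_pos y hy0)
        have h4 : d / w y * ((1 - β a) * w y) ≤
            d / w y * ((1 - β y) * (q y + w y) - κ * β y * (q y - t * w y)) := by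
          gcongr
          nlinarith
        have h5 : d / w y * ((1 - β a) * w y) = r := by rw [hr]; field_simp
        linarith)
  have h0 := s.F_pos ha
  have hlast : a ≤ a + g / r := by
    have := div_pos s.hg hr0
    linarith
  have h1 := hgrow _ hlast
  have h2 := hF _ hlast
  have h3 : r * (a + g / r) = r * a + g := by field_simp
  linarith

/-- If `F` is nonincreasing at a point of the closed unconstrained region, then this point has
positive excess and the sign persists for larger `β`. -/
lemma excess_pos_of_deriv_nonpos (s : LeverageSystem κ t d g k w β q F) {x : ℝ} (hx : 0 < x)
    (hF : F x ≤ g) (hN : (1 - β x) * (q x + w x) - κ * β x * (q x - t * w x) ≤ 0) :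
    0 < k * g / d - t * (1 - β x) ∧
      (1 - β x) * (k * g / d) + (1 - β x) ^ 2 ≤ κ * β x * (k * g / d - t * (1 - β x)) := by
  have hβ := sub_pos.2 (s.β_lt_one hx)
  have hw := s.w_pos x hx
  have hM : 0 < k * g / d := div_pos (mul_pos s.hk s.hg) s.hd
  have h1 := s.q_mul hx hF
  have hκβ := mul_pos s.hκ (s.β_pos x hx)
  have h2 : (1 - β x) * (k * g / d) + (1 - β x) ^ 2 ≤ κ * β x * (k * g / d - t * (1 - β x)) := by
    refine le_of_mul_le_mul_left ?_ hw
    have h3 := mul_nonpos_of_nonneg_of_nonpos hβ.le hN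
    linear_combination h3 - ((1 - β x) - κ * β x) * h1
  refine ⟨?_, h2⟩
  have h3 : 0 < (1 - β x) * (k * g / d) + (1 - β x) ^ 2 := by positivity
  exact (pos_iff_pos_of_mul_pos (h3.trans_le h2)).1 hκβ

lemma deriv_nonpos_of_β_le (s : LeverageSystem κ t d g k w β q F) {x y : ℝ} (hx : 0 < x)
    (hy : 0 < y) (hFy : F y ≤ g) (hβ : β x ≤ β y) (hE : 0 < k * g / d - t * (1 - β x))
    (hΦ : (1 - β x) * (k * g / d) + (1 - β x) ^ 2 ≤ κ * β x * (k * g / d - t * (1 - β x))) :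
    (1 - β y) * (q y + w y) - κ * β y * (q y - t * w y) ≤ 0 := by
  have hβy := sub_pos.2 (s.β_lt_one hy)
  have hw := s.w_pos y hy
  have hM : 0 < k * g / d := div_pos (mul_pos s.hk s.hg) s.hd
  have h1 := s.q_mul hy hFy
  have hκ := s.hκ
  have ht := s.ht
  have hβx := s.β_pos x hx
  have hβy0 := s.β_pos y hy
  have h2 : κ * β x * (k * g / d - t * (1 - β x)) ≤ κ * β y * (k * g / d - t * (1 - β y)) := by
    gcongr
  have h3 : (1 - β y) * (k * g / d) + (1 - β y) ^ 2 ≤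
      (1 - β x) * (k * g / d) + (1 - β x) ^ 2 := by
    gcongr
  refine nonpos_of_mul_nonpos_left (b := 1 - β y) ?_ hβy
  have h4 := mul_le_mul_of_nonneg_left (h3.trans (hΦ.trans h2)) hw.le
  linear_combination h4 + ((1 - β y) - κ * β y) * h1

lemma deriv_pos_of_lt (s : LeverageSystem κ t d g k w β q F) {x : ℝ} (hx : 0 < x)
    (hF : F x < g) : 0 < (1 - β x) * (q x + w x) - κ * β x * (q x - t * w x) := by
  by_contra! hN
  obtain ⟨hE, hΦ⟩ := s.excess_pos_of_deriv_nonpos hx hF.le hN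
  refine s.not_forall_lt hx fun y hxy => ?_
  by_contra! hFy
  have hcont : ContinuousOn F (Icc x y) := s.continuousOn_F.mono fun z hz => hx.trans_le hz.1
  have hclosed : IsClosed (Icc x y ∩ F ⁻¹' Ici g) := hcont.preimage_isClosed_of_isClosed
    isClosed_Icc isClosed_Ici
  obtain ⟨z, ⟨hz, hFz⟩, hmin⟩ :=
    (isCompact_Icc.of_isClosed_subset hclosed inter_subset_left).exists_isLeast
      ⟨y, ⟨hxy, le_rfl⟩, hFy⟩
  have hlt : ∀ u, x ≤ u → u < z → F u < g := fun u hxu huz => by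
    by_contra! hu
    exact absurd (hmin ⟨⟨hxu, huz.le.trans hz.2⟩, hu⟩) (not_le.2 huz)
  have h := le_of_hasDerivAt_nonneg (f := fun u => -F u) hz.1
    (fun u hu _ => (s.F_deriv (hx.trans_le hu)).fun_neg) (fun u hu huz => by
      have hu0 := hx.trans hu
      have hβ := s.β_le hx hu.le (fun v hv hvu => (hlt v hv (hvu.trans_lt huz)).le) hE
      have h1 := s.deriv_nonpos_of_β_le hx hu0 (hlt u hu.le huz).le hβ hE hΦ
      exact neg_nonneg.2
        (mul_nonpos_of_nonneg_of_nonpos (div_pos s.hd (s.w_pos u hu0)).le h1))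
  have : g ≤ F z := hFz
  simp only [neg_le_neg_iff] at h
  linarith

lemma deriv_pos_of_eq (s : LeverageSystem κ t d g k w β q F) {x : ℝ} (hx : 0 < x)
    (hF : F x = g) : 0 < (1 - β x) * (q x + w x) - κ * β x * (q x - t * w x) := by
  by_contra! hN
  obtain ⟨hE, hΦ⟩ := s.excess_pos_of_deriv_nonpos hx hF.le hN
  have hκ := s.hκ
  have ht := s.ht
  have hk := s.hk
  have hg := s.hg
  have hd := s.hd
  have hβx := s.β_pos x hx
  have hβ1 := sub_pos.2 (s.β_lt_one hx)
  have hwx := s.w_pos x hx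
  have hqx := s.q_pos x hx
  have hqw : 0 < q x - t * w x := by
    have : 0 < κ * β x * (q x - t * w x) := by
      have : 0 < (1 - β x) * (q x + w x) := by positivity
      linarith
    exact (pos_iff_pos_of_mul_pos this).1 (by positivity)
  have hβinc : ∀ᶠ y in nhdsWithin x (Ioi x), β x < β y := by
    have h := (s.β_deriv x hx).fun_neg.eventually_lt_right (neg_neg_of_pos (by positivity))
    simpa using h
  have key : ∃ᶠ y in nhdsWithin x (Ioi x), F y < g := by
    rcases hN.lt_or_eq with hN | hN
    · have h := (s.F_deriv hx).eventually_lt_right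
        (mul_neg_of_pos_of_neg (div_pos hd hwx) hN)
      rw [hF] at h
      exact h.frequently
    intro hnot
    have hqk : q x = k := le_antisymm
      (not_lt.1 fun h => ((s.lt_iff hx).2 h).ne hF) (not_lt.1 fun h => ((s.gt_iff hx).2 h).ne' hF)
    have hF' := s.F_deriv hx
    rw [hN, mul_zero] at hF'
    have hw' := s.w_deriv x hx
    have hβ' := s.β_deriv x hx
    have hQ' : HasDerivAt (fun y => k * (2 - F y / g)) 0 x := by
      simpa using ((hF'.div_const g).const_sub 2).const_mul k
    have hQx : k * (2 - F x / g) = q x := by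
      rw [hF, div_self hg.ne', hqk]
      ring
    have hD := ((hβ'.const_sub 1).fun_mul (hQ'.fun_add hw')).fun_sub
      ((hβ'.const_mul κ).fun_mul (hQ'.fun_sub (hw'.const_mul t)))
    rw [hQx] at hD
    have hDneg := hD.eventually_lt_right (by
      have h1 : 0 < κ * β x * (q x - t * w x) := by positivity
      have h2 : 0 < w x * (q x + w x) := by positivity
      have e1 := mul_pos h1 (add_pos hqx hwx)
      have e2 := mul_pos hβ1 h2
      have e3 := mul_pos (mul_pos hκ h1) hqw
      have e4 := mul_pos (mul_pos (mul_pos hκ hβx) ht) h2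
      linarith)
    simp only [hQx, hN] at hDneg
    obtain ⟨b, hb, hsub⟩ := mem_nhdsGT_iff_exists_Ioo_subset.1 (hnot.and hDneg)
    have hxb : x < b := hb
    have hanti : StrictAntiOn F (Ico x b) := by
      refine strictAntiOn_of_hasDerivWithinAt_neg (convex_Ico x b)
        (s.continuousOn_F.mono fun z hz => hx.trans_le hz.1)
        (fun y hy => (s.F_deriv (hx.trans_le (interior_subset hy).1)).hasDerivWithinAt)
        (fun y hy => ?_)
      rw [interior_Ico] at hy
      have hy0 := hx.trans hy.1
      obtain ⟨h1, h2⟩ := hsub hy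
      have h1' : q y ≤ k := not_lt.1 fun h => h1 ((s.lt_iff hy0).2 h)
      have h3 : k * (2 - F y / g) = q y := by
        rw [s.constrained y hy0 h1']
        field_simp
        ring
      simp only [h3] at h2
      exact mul_neg_of_pos_of_neg (div_pos hd (s.w_pos y hy0)) h2
    have hmid : (x + b) / 2 ∈ Ioo x b := ⟨by linarith, by linarith⟩
    have h1 := hanti (left_mem_Ico.2 hxb) ⟨hmid.1.le, hmid.2⟩ hmid.1
    exact (hsub hmid).1 (hF ▸ h1)
  obtain ⟨y, hFy, hβy, hxy⟩ := (key.and_eventually (hβinc.and self_mem_nhdsWithin)).exists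
  have hy0 : 0 < y := hx.trans hxy
  exact absurd (s.deriv_pos_of_lt hy0 hFy)
    (not_lt.2 (s.deriv_nonpos_of_β_le hx hy0 hFy.le hβy.le hE hΦ))

/-- Once the constraint is reached it binds strictly from then on. -/
lemma lt_of_le_of_lt (s : LeverageSystem κ t d g k w β q F) {x y : ℝ} (hx : 0 < x)
    (hFx : g ≤ F x) (hxy : x < y) : g < F y := by
  by_contra! hFy
  have hcont : ContinuousOn F (Icc x y) := s.continuousOn_F.mono fun z hz => hx.trans_le hz.1
  have hno : ∀ z, x < z → z ≤ y → F z ≤ g → ∃ u ∈ Icc x y, F u < F z := fun z hxz hzy hFz => by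
    have hz0 := hx.trans hxz
    have hN : 0 < (1 - β z) * (q z + w z) - κ * β z * (q z - t * w z) :=
      hFz.lt_or_eq.elim (s.deriv_pos_of_lt hz0) (s.deriv_pos_of_eq hz0)
    have h := (s.F_deriv hz0).eventually_lt_left (mul_pos (div_pos s.hd (s.w_pos z hz0)) hN)
    obtain ⟨u, hu, hxu⟩ := (h.and (Ioo_mem_nhdsLT hxz)).exists
    exact ⟨u, ⟨hxu.1.le, hxu.2.le.trans hzy⟩, hu⟩
  obtain ⟨z, hz, hmin⟩ := isCompact_Icc.exists_isMinOn (nonempty_Icc.2 hxy.le) hcont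
  rw [isMinOn_iff] at hmin
  have hzy := hmin y ⟨hxy.le, le_rfl⟩
  rcases hz.1.eq_or_lt with rfl | hxz
  · obtain ⟨u, hu, hlt⟩ := hno y hxy le_rfl hFy
    linarith [hmin u hu]
  · obtain ⟨u, hu, hlt⟩ := hno z hxz hz.2 (hzy.trans hFy)
    linarith [hmin u hu]

theorem exists_threshold (s : LeverageSystem κ t d g k w β q F) (h0 : ∃ x > 0, F x < g) :
    ∃ xstar > 0, ∀ x > 0, (k < q x ↔ x < xstar) ∧ (q x < k ↔ xstar < x) := by
  obtain ⟨a, ha, hFa⟩ := h0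
  obtain ⟨b, hab, hFb⟩ : ∃ b, a ≤ b ∧ g ≤ F b := by
    by_contra! h
    exact s.not_forall_lt ha h
  obtain ⟨z, hz, hFz⟩ := intermediate_value_Icc hab
    (s.continuousOn_F.mono fun z hz => ha.trans_le hz.1) ⟨hFa.le, hFb⟩
  have hz0 : 0 < z := ha.trans_le hz.1
  have hright : ∀ x, z < x → g < F x := fun x hx => s.lt_of_le_of_lt hz0 hFz.ge hx
  have hleft : ∀ x > 0, x < z → F x < g := fun x hx hxz => by
    by_contra! h
    exact (s.lt_of_le_of_lt hx h hxz).ne' hFz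
  refine ⟨z, hz0, fun x hx => ?_⟩
  rw [← s.lt_iff hx, ← s.gt_iff hx]
  refine ⟨⟨fun h => ?_, hleft x hx⟩, ⟨fun h => ?_, hright x⟩⟩
  · by_contra! hzx
    rcases hzx.eq_or_lt with rfl | hzx
    · exact h.ne hFz
    · exact lt_asymm h (hright x hzx)
  · by_contra! hzx
    rcases hzx.eq_or_lt with rfl | hzx
    · exact h.ne' hFz
    · exact lt_asymm h (hleft x hx hzx)

end LeverageSystem

/-- The constrained maximum of the Hamiltonian when the unconstrained maximizer is admissible. -/
lemma sSup_leverage_unconstrained {μ σ L p q : ℝ} (hμ : 0 < μ) (hσ : 0 < σ) (hp : 0 < p)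
    (hq : 0 < q) (h : μ / (σ ^ 2 * q) ≤ L) :
    sSup {y | ∃ pi : ℝ, |pi| ≤ L ∧ y = pi * μ * p + σ ^ 2 * pi ^ 2 * (-(q * p)) / 2} =
      μ ^ 2 / (2 * σ ^ 2 * q) * p := by
  refine IsGreatest.csSup_eq ⟨⟨μ / (σ ^ 2 * q), ?_, ?_⟩, ?_⟩
  · rwa [abs_of_pos (by positivity)]
  · field_simp
    ring
  · rintro y ⟨pi, -, rfl⟩
    have h1 : μ ^ 2 / (2 * σ ^ 2 * q) * p - (pi * μ * p + σ ^ 2 * pi ^ 2 * (-(q * p)) / 2) =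
        p * q * σ ^ 2 / 2 * (pi - μ / (σ ^ 2 * q)) ^ 2 := by
      field_simp
      ring
    have h2 : 0 ≤ p * q * σ ^ 2 / 2 * (pi - μ / (σ ^ 2 * q)) ^ 2 := by positivity
    linarith

/-- The constrained maximum of the Hamiltonian when the leverage bound binds. -/
lemma sSup_leverage_constrained {μ σ L p q : ℝ} (hL : 0 < L) (hp : 0 < p)
    (hq : 0 < q) (h : q * (L * σ ^ 2) ≤ μ) :
    sSup {y | ∃ pi : ℝ, |pi| ≤ L ∧ y = pi * μ * p + σ ^ 2 * pi ^ 2 * (-(q * p)) / 2} =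
      (L * μ - σ ^ 2 * L ^ 2 * q / 2) * p := by
  refine IsGreatest.csSup_eq ⟨⟨L, (abs_of_pos hL).le, by ring⟩, ?_⟩
  rintro y ⟨pi, hpi, rfl⟩
  have h1 : pi ≤ L := (le_abs_self pi).trans hpi
  have h2 : 0 ≤ p * (L - pi) * (μ - q * (L * σ ^ 2)) := by
    have := sub_nonneg.2 h1
    have := sub_nonneg.2 h
    positivity
  have h3 : 0 ≤ p * q * σ ^ 2 * (L - pi) ^ 2 := by positivity
  linarith

/-- Theorem 6.5, deterministic form: under a constant leverage bound
`g ≡ L` with `r = 0`, for a solution `J` of the HJB equation with the stated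
regularity and boundary behaviour, the unconstrained region
`𝒰 = {x > 0 : -(μ/σ²) J'/J'' < L}` is an interval `(0, x*)` and the constrained region
`ℬ = {x > 0 : -(μ/σ²) J'/J'' > L}` is `(x*, ∞)`. -/
theorem constant_leverage_two_regions
    (μ σ δ L R S ν ρ : ℝ)
    (hμ : 0 < μ) (hσ : 0 < σ) (hδ : 0 < δ) (hL : 0 < L)
    (hS : 0 < S) (hSR : S < R) (hR : R < 1)
    (hν : ν = (1 - R) / (1 - S)) (hν0 : 0 < ν) (hν1 : ν < 1)
    (hρ : ρ = 1 - 1 / ν)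
    (J J' J'' : ℝ → ℝ)
    (hJpos : ∀ x > (0 : ℝ), 0 < J x)
    (hd1 : ∀ x > (0 : ℝ), HasDerivAt J (J' x) x)
    (hd2 : ∀ x > (0 : ℝ), HasDerivAt J' (J'' x) x)
    (hJ''cont : ContinuousOn J'' (Ioi 0))
    (hJ'pos : ∀ x > (0 : ℝ), 0 < J' x)
    (hJ''neg : ∀ x > (0 : ℝ), J'' x < 0)
    (hC4U : ContDiffOn ℝ 4 J {x | 0 < x ∧ -(μ / σ ^ 2) * (J' x / J'' x) < L})
    (hC4B : ContDiffOn ℝ 4 J {x | 0 < x ∧ L < -(μ / σ ^ 2) * (J' x / J'' x)})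
    (hHJB : ∀ x > (0 : ℝ),
      δ * ν * J x =
        sSup {y | ∃ pi : ℝ, |pi| ≤ L ∧
          y = pi * μ * J' x + σ ^ 2 * pi ^ 2 * J'' x / 2} +
        S / (1 - S) * ((1 - R) * J x) ^ (ρ / S) * (J' x) ^ (1 - 1 / S))
    (hlim0 : Tendsto J (nhdsWithin 0 (Ioi 0)) (nhds 0))
    (hlim1 : Tendsto J' (nhdsWithin 0 (Ioi 0)) atTop) :
    ∃ xstar > (0 : ℝ),
      {x | 0 < x ∧ -(μ / σ ^ 2) * (J' x / J'' x) < L} = Ioo 0 xstar ∧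
      {x | 0 < x ∧ L < -(μ / σ ^ 2) * (J' x / J'' x)} = Ioi xstar := by
  have hR' : 0 < 1 - R := by linarith
  have hS' : 0 < 1 - S := by linarith
  have hR0 : 0 < R := hS.trans hSR
  have hd : 0 < δ * ν := mul_pos hδ hν0
  set β : ℝ → ℝ := fun x =>
    S / (1 - S) * ((1 - R) * J x) ^ (ρ / S) * (J' x) ^ (1 - 1 / S) / (δ * ν * J x) with hβ
  set w : ℝ → ℝ := fun x => J' x / J x with hw
  set q : ℝ → ℝ := fun x => -(J'' x / J' x) with hq
  have hqpos : ∀ x > 0, 0 < q x := fun x hx =>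
    neg_pos.2 (div_neg_of_neg_of_pos (hJ''neg x hx) (hJ'pos x hx))
  have hJ'' : ∀ x > 0, J'' x = -(q x * J' x) := fun x hx => by
    have := (hJ'pos x hx).ne'
    simp only [hq]
    field_simp
  have hF : ∀ x > 0, δ * ν * (1 - β x) / w x =
      sSup {y | ∃ pi : ℝ, |pi| ≤ L ∧
        y = pi * μ * J' x + σ ^ 2 * pi ^ 2 * (-(q x * J' x)) / 2} / J' x := fun x hx => by
    have h1 := hHJB x hx
    rw [hJ'' x hx, ← sub_eq_iff_eq_add] at h1
    rw [← h1]
    have := hJpos x hx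
    have := hJ'pos x hx
    simp only [hβ, hw]
    field_simp
  have sys : LeverageSystem ((1 - S) / S) (R / (1 - R)) (δ * ν) (L * μ / 2) (μ / (L * σ ^ 2))
      w β q (fun x => δ * ν * (1 - β x) / w x) :=
    { hκ := by positivity
      ht := by positivity
      hd := hd
      hg := by positivity
      hk := by positivity
      w_pos := fun x hx => div_pos (hJ'pos x hx) (hJpos x hx)
      β_pos := fun x hx => by
        have := hJpos x hx
        have := hJ'pos x hx
        simp only [hβ]
        positivity
      q_pos := hqpos
      F_eq := fun x _ => rfl
      w_deriv := fun x hx => by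
        have h0 := hJpos x hx
        have h1 := hJ'pos x hx
        refine ((hd2 x hx).fun_div (hd1 x hx) h0.ne').congr_deriv ?_
        simp only [hw, hq]
        field_simp
        ring
      β_deriv := fun x hx => by
        have h0 := hJpos x hx
        have h1 := hJ'pos x hx
        have h2 : (1 - R) * J x ≠ 0 := by positivity
        have e1 := (((hd1 x hx).const_mul (1 - R)).rpow_const (p := ρ / S)
          (Or.inl h2)).const_mul (S / (1 - S))
        have e2 := (hd2 x hx).rpow_const (p := 1 - 1 / S) (Or.inl h1.ne')
        have e3 := (e1.fun_mul e2).fun_div ((hd1 x hx).const_mul (δ * ν)) (by positivity)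
        refine e3.congr_deriv ?_
        rw [rpow_sub_one h2, rpow_sub_one h1.ne']
        have hρ' : ρ = (S - R) / (1 - R) := by
          rw [hρ, hν]
          field_simp
          ring
        simp only [hβ, hw, hq]
        generalize ((1 - R) * J x) ^ (ρ / S) = A
        generalize (J' x) ^ (1 - 1 / S) = B
        rw [hρ']
        field_simp
        ring
      unconstrained := fun x hx h => by
        have h1 := hJ'pos x hx
        have h2 := hqpos x hx
        have h3 : μ / (σ ^ 2 * q x) ≤ L := by
          rw [div_le_iff₀ (by positivity)] at h ⊢
          linarith
        rw [hF x hx, sSup_leverage_unconstrained hμ hσ h1 h2 h3]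
        field_simp
      constrained := fun x hx h => by
        have h1 := hJ'pos x hx
        have h2 := hqpos x hx
        rw [le_div_iff₀ (by positivity)] at h
        rw [hF x hx, sSup_leverage_constrained hL h1 h2 h]
        field_simp }
  have hstart : ∃ x > 0, δ * ν * (1 - β x) / w x < L * μ / 2 := by
    have e1 := hlim0.eventually (gt_mem_nhds (show 0 < L * μ / 2 / (δ * ν) by positivity))
    have e2 := hlim1.eventually (eventually_ge_atTop 1)
    obtain ⟨x, ⟨h1, h2⟩, hx⟩ := ((e1.and e2).and self_mem_nhdsWithin).exists
    have hx0 : 0 < x := hx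
    refine ⟨x, hx0, ?_⟩
    have hJx := hJpos x hx0
    have hβx := sys.β_pos x hx0
    rw [div_lt_iff₀ (sys.w_pos x hx0)]
    rw [lt_div_iff₀ hd] at h1
    have h3 : L * μ / 2 / J x ≤ L * μ / 2 * w x := by
      simp only [hw]
      rw [div_eq_mul_inv, div_eq_mul_inv (J' x)]
      gcongr
      exact le_mul_of_one_le_left (by positivity) h2
    have h4 : δ * ν < L * μ / 2 / J x := by
      rw [lt_div_iff₀ hJx]
      linarith
    have h5 := mul_pos hd hβx
    linarith
  obtain ⟨z, hz, H⟩ := sys.exists_threshold hstart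
  have hratio : ∀ x > 0, -(μ / σ ^ 2) * (J' x / J'' x) = μ / (σ ^ 2 * q x) := fun x hx => by
    have h1 := (hJ'pos x hx).ne'
    have h2 := (hqpos x hx).ne'
    rw [hJ'' x hx]
    field_simp
  refine ⟨z, hz, ?_, ?_⟩
  · ext x
    simp only [mem_ofPred_eq, mem_Ioo]
    refine and_congr_right fun hx => ?_
    have h2 := hqpos x hx
    rw [← (H x hx).1, hratio x hx, div_lt_iff₀ (by positivity), div_lt_iff₀ (by positivity)]
    ring_nf
  · ext x
    simp only [mem_ofPred_eq, mem_Ioi]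
    have key : ∀ hx : 0 < x, L < -(μ / σ ^ 2) * (J' x / J'' x) ↔ z < x := fun hx => by
      have h2 := hqpos x hx
      rw [← (H x hx).2, hratio x hx, lt_div_iff₀ (by positivity), lt_div_iff₀ (by positivity)]
      ring_nf
    exact ⟨fun h => (key h.1).1 h.2, fun h => ⟨hz.trans h, (key (hz.trans h)).2 h⟩⟩
end

section
/- (Proposition 6.7, deterministic form.) Let $0<r<\mu$, $\sigma>0$, $\delta>0$, $0<S<R<1$, $\nu=(1-R)/(1-S)\in(0,1)$, $\rho=1-1/\nu$, $k\ge 0$, $L>0$, and $g(x)=kx+L$. Let $J:(0,\infty)\to(0,\infty)$ be $C^{2}$ with $J'>0$ and $J''<0$, satisfying for every $x>0$ the HJB equation $\delta\nu J(x)=\sup_{|\pi|\le kx+L}\left[\pi(\mu-r)J'(x)+\tfrac12\sigma^{2}\pi^{2}J''(x)\right]+\frac{S}{1-S}((1-R)J(x))^{\rho/S}(J'(x))^{1-1/S}+rxJ'(x)$, together with $\lim_{x\to 0^{+}}J(x)=0$ and $\lim_{x\to 0^{+}}J'(x)=+\infty$. Then there exists $\hat x>0$ such that $-\frac{\mu-r}{\sigma^{2}}\frac{J'(x)}{J''(x)}<kx+L$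 for all $x\in(0,\hat x)$, i.e. the leverage constraint is not binding near zero. -/
open Real Set Filter

set_option autoImplicit false

/-- When the leverage constraint `|π| ≤ g` binds, the supremum of the quadratic
`π a p + σ² π² q / 2` is at least half of its linear part at `π = g`. -/
lemma half_linear_le_sSup_of_binding {a σ p q g : ℝ} (ha : 0 < a) (hσ : 0 < σ) (hp : 0 < p)
    (hq : q < 0) (hg : 0 < g) (hbind : g ≤ -(a / σ ^ 2) * (p / q)) :
    g * a * p / 2 ≤
      sSup {y | ∃ pi : ℝ, |pi| ≤ g ∧ y = pi * a * p + σ ^ 2 * pi ^ 2 * q / 2} := by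
  have hbdd : BddAbove {y | ∃ pi : ℝ, |pi| ≤ g ∧ y = pi * a * p + σ ^ 2 * pi ^ 2 * q / 2} := by
    refine ⟨g * a * p, ?_⟩
    rintro y ⟨pi, hpi, rfl⟩
    have hlin : pi * a * p ≤ g * a * p := by
      have := (abs_le.mp hpi).2
      gcongr
    have hquad : σ ^ 2 * pi ^ 2 * q ≤ 0 :=
      mul_nonpos_of_nonneg_of_nonpos (by positivity) hq.le
    linarith
  have hfoc : g * (σ ^ 2 * -q) ≤ a * p := by
    rw [← le_div_iff₀ (mul_pos (pow_pos hσ 2) (neg_pos.mpr hq))]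
    refine hbind.trans_eq ?_
    have := hq.ne
    field_simp
  have hmem := le_csSup hbdd ⟨g, (abs_of_pos hg).le, rfl⟩
  have := mul_le_mul_of_nonneg_left hfoc hg.le
  linarith

/-- Proposition 6.7, deterministic form: under a linear leverage bound
`g(x) = kx + L` with `L > 0`, the leverage constraint is not binding near zero: there
exists `x̂ > 0` with `-(μ-r)/σ² · J'/J'' < kx + L` on `(0, x̂)`. -/
theorem constraint_not_binding_near_zero
    (μ r σ δ R S ν ρ k L : ℝ)
    (hr : 0 < r) (hrμ : r < μ) (hσ : 0 < σ) (hδ : 0 < δ)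
    (hS : 0 < S) (hSR : S < R) (hR : R < 1)
    (hν : ν = (1 - R) / (1 - S)) (hν0 : 0 < ν) (hν1 : ν < 1)
    (hρ : ρ = 1 - 1 / ν)
    (hk : 0 ≤ k) (hL : 0 < L)
    (J J' J'' : ℝ → ℝ)
    (hJpos : ∀ x > (0 : ℝ), 0 < J x)
    (hd1 : ∀ x > (0 : ℝ), HasDerivAt J (J' x) x)
    (hd2 : ∀ x > (0 : ℝ), HasDerivAt J' (J'' x) x)
    (hJ''cont : ContinuousOn J'' (Ioi 0))
    (hJ'pos : ∀ x > (0 : ℝ), 0 < J' x)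
    (hJ''neg : ∀ x > (0 : ℝ), J'' x < 0)
    (hHJB : ∀ x > (0 : ℝ),
      δ * ν * J x =
        sSup {y | ∃ pi : ℝ, |pi| ≤ k * x + L ∧
          y = pi * (μ - r) * J' x + σ ^ 2 * pi ^ 2 * J'' x / 2} +
        S / (1 - S) * ((1 - R) * J x) ^ (ρ / S) * (J' x) ^ (1 - 1 / S) +
        r * x * J' x)
    (hlim0 : Tendsto J (nhdsWithin 0 (Ioi 0)) (nhds 0))
    (hlim1 : Tendsto J' (nhdsWithin 0 (Ioi 0)) atTop) :
    ∃ xhat > (0 : ℝ), ∀ x, 0 < x → x < xhat →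
      -((μ - r) / σ ^ 2) * (J' x / J'' x) < k * x + L := by
  have ha : 0 < μ - r := sub_pos.mpr hrμ
  have hJsmall : ∀ᶠ x in nhdsWithin 0 (Ioi 0), J x < 1 / (δ * ν) :=
    hlim0.eventually_lt_const (by positivity)
  have hJ'large : ∀ᶠ x in nhdsWithin 0 (Ioi 0), 2 / (L * (μ - r)) < J' x :=
    hlim1.eventually_gt_atTop _
  obtain ⟨xhat, hxhat, hsub⟩ :=
    mem_nhdsGT_iff_exists_Ioo_subset.mp (hJsmall.and hJ'large)
  refine ⟨xhat, hxhat, fun x hx hxlt => ?_⟩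
  obtain ⟨hJx, hJ'x⟩ := hsub ⟨hx, hxlt⟩
  by_contra! hbind
  have hkx : 0 ≤ k * x := by positivity
  have hp := hJ'pos x hx
  have hsup := half_linear_le_sSup_of_binding ha hσ hp (hJ''neg x hx) (by linarith) hbind
  have hcons : 0 ≤ S / (1 - S) * ((1 - R) * J x) ^ (ρ / S) * (J' x) ^ (1 - 1 / S) := by
    have hS1 : 0 < 1 - S := by linarith
    have hR1 : 0 < 1 - R := by linarith
    have := hJpos x hx
    positivity
  have hrx : 0 ≤ r * x * J' x := by positivity
  have hL_le : L * (μ - r) * J' x ≤ (k * x + L) * (μ - r) * J' x := by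
    gcongr
    linarith
  rw [lt_div_iff₀ (by positivity)] at hJx
  rw [div_lt_iff₀ (by positivity)] at hJ'x
  linarith [hHJB x hx]
end

section
/- (Proposition 6.3(ii), deterministic form.) Let $0<r<\mu$, $\sigma>0$, $\delta>0$, $0<S<R<1$, $\nu=(1-R)/(1-S)\in(0,1)$, $\rho=1-1/\nu$, $\kappa=(\mu-r)^2/(2\sigma^2)$, $\eta=\frac{1}{S}[\delta+(S-1)(r+\kappa/R)]>0$, $0<k<\frac{\mu-r}{R\sigma^{2}}$, $\bar L>0$, and $\eta^{0}=\frac{S-1}{S}[k(\mu-r)-\tfrac12\sigma^{2}Rk^{2}+r-\frac{\delta\nu}{1-R}]$. Let $J:(0,\infty)\to(0,\infty)$ be differentiable with $J'>0$ and suppose that for all $x>0$: $(\eta^{0})^{-\nu S}\frac{x^{1-R}}{1-R}\le J(x)\le \eta^{-\nu S}\frac{x^{1-R}}{1-R}$, $J(x)\le(\eta^{0})^{-\nu S}\frac{(x+\bar L)^{1-R}}{1-R}$, and $xJ'(x)\le(1-R)J(x)\le(x+\bar L)J'(x)$. Define the feedback consumption $c^{*}(x)=(J'(x))^{-1/S}\big((1-R)J(x)\big)^{\rho/S}$.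 Then for every $x>0$, $\max\left\{\eta x,\;\eta^{0}x\left(\frac{x}{x+\bar L}\right)^{\frac1S-1}\right\}\le c^{*}(x)\le \eta^{0}x\left(\frac{x+\bar L}{x}\right)^{\frac1S}$. -/
open Real Set

set_option autoImplicit false

/-- The negative power `-1/(νS)` undoes the scaling `a ^ (-(νS)) * y ^ (ν(1-S))`. -/
theorem rpow_scaling_inverse {a y ν S : ℝ} (ha : 0 < a) (hy : 0 < y) (hν : 0 < ν) (hS : 0 < S) :
    (a ^ (-(ν * S)) * y ^ (ν * (1 - S))) ^ (-(1 / (ν * S))) = a * y ^ (1 - 1 / S) := by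
  rw [mul_rpow (by positivity) (by positivity), ← rpow_mul ha.le, ← rpow_mul hy.le]
  have h₁ : -(ν * S) * -(1 / (ν * S)) = 1 := by field_simp
  have h₂ : ν * (1 - S) * -(1 / (ν * S)) = 1 - 1 / S := by field_simp; ring
  rw [h₁, h₂, rpow_one]

/-- Substituting `p = v / y` into the feedback consumption. -/
theorem feedback_consumption_div {v y ν S : ℝ} (hv : 0 < v) (hy : 0 < y) (hν : 0 < ν)
    (hS : 0 < S) :
    (v / y) ^ (-(1 / S)) * v ^ ((1 - 1 / ν) / S) = y ^ (1 / S) * v ^ (-(1 / (ν * S))) := by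
  rw [div_rpow hv.le hy.le, rpow_neg hy.le, div_inv_eq_mul, mul_comm (v ^ _), mul_assoc,
    ← rpow_add hv]
  congr 2
  field_simp
  ring

/-- The maximal growth rate of a proportional-leverage strategy is attained at the Merton ratio. -/
theorem leverage_growth_le {m σ R k : ℝ} (hσ : 0 < σ) (hR : 0 < R) :
    k * m - σ ^ 2 * R * k ^ 2 / 2 ≤ m ^ 2 / (2 * σ ^ 2) / R := by
  have h : m ^ 2 / (2 * σ ^ 2) / R - (k * m - σ ^ 2 * R * k ^ 2 / 2) =
      (m - σ ^ 2 * R * k) ^ 2 / (2 * σ ^ 2 * R) := by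
    field_simp
    ring
  have : 0 ≤ (m - σ ^ 2 * R * k) ^ 2 / (2 * σ ^ 2 * R) := by positivity
  linarith

/-- Proposition 6.3(ii), deterministic form: bounds on the feedback
consumption `c*(x) = (J'(x))^(-1/S) ((1-R)J(x))^(ρ/S)` under the stated value-function
bounds and homogeneity inequalities:
`max{ηx, η⁰x (x/(x+L̄))^(1/S-1)} ≤ c*(x) ≤ η⁰x ((x+L̄)/x)^(1/S)`. -/
theorem consumption_bounds
    (μ r σ δ R S ν ρ κ η k η0 Lbar : ℝ)
    (hr : 0 < r) (hrμ : r < μ) (hσ : 0 < σ) (hδ : 0 < δ)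
    (hS : 0 < S) (hSR : S < R) (hR : R < 1)
    (hν : ν = (1 - R) / (1 - S)) (hν0 : 0 < ν) (hν1 : ν < 1)
    (hρ : ρ = 1 - 1 / ν)
    (hκ : κ = (μ - r) ^ 2 / (2 * σ ^ 2))
    (hη : η = (1 / S) * (δ + (S - 1) * (r + κ / R))) (hηpos : 0 < η)
    (hk0 : 0 < k) (hk : k < (μ - r) / (R * σ ^ 2)) (hLbar : 0 < Lbar)
    (hη0 : η0 = (S - 1) / S *
      (k * (μ - r) - σ ^ 2 * R * k ^ 2 / 2 + r - δ * ν / (1 - R)))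
    (J J' : ℝ → ℝ)
    (hJpos : ∀ x > (0 : ℝ), 0 < J x)
    (hd : ∀ x > (0 : ℝ), HasDerivAt J (J' x) x)
    (hJ'pos : ∀ x > (0 : ℝ), 0 < J' x)
    (hlb : ∀ x > (0 : ℝ), η0 ^ (-(ν * S)) * (x ^ (1 - R) / (1 - R)) ≤ J x)
    (hub : ∀ x > (0 : ℝ), J x ≤ η ^ (-(ν * S)) * (x ^ (1 - R) / (1 - R)))
    (hub2 : ∀ x > (0 : ℝ), J x ≤ η0 ^ (-(ν * S)) * ((x + Lbar) ^ (1 - R) / (1 - R)))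
    (hhom1 : ∀ x > (0 : ℝ), x * J' x ≤ (1 - R) * J x)
    (hhom2 : ∀ x > (0 : ℝ), (1 - R) * J x ≤ (x + Lbar) * J' x) :
    ∀ x > (0 : ℝ),
      max (η * x) (η0 * x * (x / (x + Lbar)) ^ (1 / S - 1)) ≤
        (J' x) ^ (-(1 / S)) * ((1 - R) * J x) ^ (ρ / S) ∧
      (J' x) ^ (-(1 / S)) * ((1 - R) * J x) ^ (ρ / S) ≤
        η0 * x * ((x + Lbar) / x) ^ (1 / S) := by
  have hS1 : 0 < 1 - S := by linarith
  have hR1 : 0 < 1 - R := by linarith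
  have hR0 : 0 < R := hS.trans hSR
  have hRν : 1 - R = ν * (1 - S) := by rw [hν]; field_simp
  have hη0pos : 0 < η0 := by
    have hle := leverage_growth_le (m := μ - r) (k := k) hσ hR0
    rw [← hκ] at hle
    have hdiff : η0 - η =
        (1 - S) / S * (κ / R - (k * (μ - r) - σ ^ 2 * R * k ^ 2 / 2)) := by
      rw [hη0, hη, hRν]
      field_simp
      ring
    have : 0 ≤ (1 - S) / S * (κ / R - (k * (μ - r) - σ ^ 2 * R * k ^ 2 / 2)) :=
      mul_nonneg (by positivity) (by linarith)
    linarith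
  intro x hx
  have hy : 0 < x + Lbar := by linarith
  have hA := hJ'pos x hx
  have hv : 0 < (1 - R) * J x := mul_pos hR1 (hJpos x hx)
  have hcancel : ∀ c d : ℝ, (1 - R) * (c * (d / (1 - R))) = c * d := fun c d => by field_simp
  have hlow := mul_le_mul_of_nonneg_left (hlb x hx) hR1.le
  have hup := mul_le_mul_of_nonneg_left (hub x hx) hR1.le
  have hup2 := mul_le_mul_of_nonneg_left (hub2 x hx) hR1.le
  have h1 := hhom1 x hx
  have h2 := hhom2 x hx
  rw [hcancel] at hlow hup hup2
  generalize (1 - R) * J x = v at *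
  rw [hRν] at hlow hup hup2
  have hq : -(1 / (ν * S)) ≤ 0 := neg_nonpos.2 (by positivity)
  have hp : -(1 / S) ≤ 0 := neg_nonpos.2 (by positivity)
  have hlow' := rpow_le_rpow_of_nonpos (by positivity) hlow hq
  have hup' := rpow_le_rpow_of_nonpos hv hup hq
  have hup2' := rpow_le_rpow_of_nonpos hv hup2 hq
  rw [rpow_scaling_inverse hη0pos hx hν0 hS] at hlow'
  rw [rpow_scaling_inverse hηpos hx hν0 hS] at hup'
  rw [rpow_scaling_inverse hη0pos hy hν0 hS] at hup2'
  have hclow : x ^ (1 / S) * v ^ (-(1 / (ν * S))) ≤ J' x ^ (-(1 / S)) * v ^ (ρ / S) := by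
    rw [hρ, ← feedback_consumption_div hv hx hν0 hS]
    gcongr ?_ * _
    exact rpow_le_rpow_of_nonpos hA ((le_div_iff₀' hx).2 h1) hp
  have hcup : J' x ^ (-(1 / S)) * v ^ (ρ / S) ≤ (x + Lbar) ^ (1 / S) * v ^ (-(1 / (ν * S))) := by
    rw [hρ, ← feedback_consumption_div hv hy hν0 hS]
    gcongr ?_ * _
    exact rpow_le_rpow_of_nonpos (by positivity) ((div_le_iff₀' hy).2 h2) hp
  have hx1 : x ^ (1 / S) * x ^ (1 - 1 / S) = x := by
    rw [← rpow_add hx, add_sub_cancel, rpow_one]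
  refine ⟨max_le (le_trans ?_ hclow) (le_trans ?_ hclow), hcup.trans ?_⟩
  · calc η * x = x ^ (1 / S) * (η * x ^ (1 - 1 / S)) := by rw [mul_left_comm, hx1]
      _ ≤ _ := by gcongr
  · calc η0 * x * (x / (x + Lbar)) ^ (1 / S - 1)
        = x ^ (1 / S) * (η0 * (x + Lbar) ^ (1 - 1 / S)) := by
          rw [div_rpow hx.le hy.le, ← neg_sub (1 / S) 1, rpow_neg hy.le, rpow_sub_one hx.ne']
          field_simp
      _ ≤ _ := by gcongr
  · calc (x + Lbar) ^ (1 / S) * v ^ (-(1 / (ν * S)))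
        ≤ (x + Lbar) ^ (1 / S) * (η0 * x ^ (1 - 1 / S)) := by gcongr
      _ = η0 * x * ((x + Lbar) / x) ^ (1 / S) := by
          rw [div_rpow hy.le hx.le, rpow_sub hx, rpow_one]
          ring
end

section
/- (Proposition 6.3(iv), deterministic form.) Let $\delta>0$, $\nu\in(0,1)$, $0<S<1$, $R\in(0,1)$, $\rho=1-1/\nu$, and $r\ge 0$. Let $J:(0,\infty)\to(0,\infty)$ be differentiable with $J'>0$, $\lim_{x\to 0^{+}}J(x)=0$ and $\lim_{x\to 0^{+}}J'(x)=+\infty$, and define $c^{*}(x)=(J'(x))^{-1/S}\big((1-R)J(x)\big)^{\rho/S}$. If $\delta\nu J(x)\ge \frac{S}{1-S}c^{*}(x)J'(x)+rxJ'(x)$ for all $x>0$, then $\lim_{x\to 0^{+}}c^{*}(x)=0$. -/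
open Real Set Filter

set_option autoImplicit false

/-- Proposition 6.3(iv), deterministic form: if
`δν J(x) ≥ (S/(1-S)) c*(x) J'(x) + r x J'(x)` for all `x > 0`, where
`c*(x) = (J'(x))^(-1/S) ((1-R)J(x))^(ρ/S)`, and `J(0+) = 0`, `J'(0+) = +∞`,
then `c*(x) → 0` as `x → 0⁺`. -/
theorem consumption_vanishes_at_zero
    (δ ν S R ρ r : ℝ)
    (hδ : 0 < δ) (hν0 : 0 < ν) (hν1 : ν < 1)
    (hS0 : 0 < S) (hS1 : S < 1)
    (hR0 : 0 < R) (hR1 : R < 1)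
    (hρ : ρ = 1 - 1 / ν) (hr : 0 ≤ r)
    (J J' : ℝ → ℝ)
    (hJpos : ∀ x > (0 : ℝ), 0 < J x)
    (hd : ∀ x > (0 : ℝ), HasDerivAt J (J' x) x)
    (hJ'pos : ∀ x > (0 : ℝ), 0 < J' x)
    (hlim0 : Tendsto J (nhdsWithin 0 (Ioi 0)) (nhds 0))
    (hlim1 : Tendsto J' (nhdsWithin 0 (Ioi 0)) atTop)
    (hineq : ∀ x > (0 : ℝ),
      S / (1 - S) * ((J' x) ^ (-(1 / S)) * ((1 - R) * J x) ^ (ρ / S)) * J' x +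
        r * x * J' x ≤ δ * ν * J x) :
    Tendsto (fun x => (J' x) ^ (-(1 / S)) * ((1 - R) * J x) ^ (ρ / S))
      (nhdsWithin 0 (Ioi 0)) (nhds 0) := by
  have hS : 0 < 1 - S := sub_pos.mpr hS1
  have hR : 0 < 1 - R := sub_pos.mpr hR1
  have hbound : Tendsto (fun x => (1 - S) / S * (δ * ν) * (J x * (J' x)⁻¹))
      (nhdsWithin 0 (Ioi 0)) (nhds 0) := by
    simpa using (hlim0.mul hlim1.inv_tendsto_atTop).const_mul ((1 - S) / S * (δ * ν))
  refine tendsto_of_tendsto_of_tendsto_of_le_of_le' tendsto_const_nhds hbound ?_ ?_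
  · filter_upwards [self_mem_nhdsWithin] with x hx
    exact mul_nonneg (rpow_nonneg (hJ'pos x hx).le _)
      (rpow_nonneg (mul_pos hR (hJpos x hx)).le _)
  · filter_upwards [self_mem_nhdsWithin] with x hx
    have hx0 : 0 < x := hx
    have hJ' := hJ'pos x hx
    have hineq' := hineq x hx
    set c := (J' x) ^ (-(1 / S)) * ((1 - R) * J x) ^ (ρ / S)
    have hle : S / (1 - S) * c * J' x ≤ δ * ν * J x := by
      have : 0 ≤ r * x * J' x := by positivity
      linarith
    calc c = (1 - S) / S * (S / (1 - S) * c * J' x) * (J' x)⁻¹ := by field_simp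
      _ ≤ (1 - S) / S * (δ * ν * J x) * (J' x)⁻¹ := by gcongr
      _ = (1 - S) / S * (δ * ν) * (J x * (J' x)⁻¹) := by ring
end

section
/- (Proposition 6.8(i), deterministic form.) Let $0<r<\mu$, $\sigma>0$, $\delta>0$, $0<S<R<1$, $\nu=(1-R)/(1-S)\in(0,1)$, $\rho=1-1/\nu$, $\kappa=(\mu-r)^2/(2\sigma^2)$, $\eta=\frac1S[\delta+(S-1)(r+\kappa/R)]>0$, and $\bar L>0$. Let $J$ be twice differentiable at $x>0$ with $J(x)>0$, $J'(x)>0$, $J''(x)<0$, and suppose the unconstrained-region equation holds at $x$: $\delta\nu J(x)=-\kappa\frac{(J'(x))^{2}}{J''(x)}+\frac{S}{1-S}c^{*}(x)J'(x)+rxJ'(x)$, where $c^{*}(x)=(J'(x))^{-1/S}((1-R)J(x))^{\rho/S}$. If moreover $(1-R)J(x)\le(x+\bar L)J'(x)$ and $c^{*}(x)\ge\eta x$, then the feedback portfolio $\pi^{*}(x)=-\frac{\mu-r}{\sigma^{2}}\frac{J'(x)}{J''(x)}$ satisfies $\pi^{*}(x)\le\frac{\mu-r}{R\sigma^{2}}x+\frac{2\delta\nu\bar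 L}{(1-R)(\mu-r)}$. -/
open Real Set

set_option autoImplicit false

/-- Proposition 6.8(i), deterministic form: upper bound on the feedback
portfolio `π*(x) = -(μ-r)/σ² · J'(x)/J''(x)`:
`π*(x) ≤ (μ-r)/(Rσ²) x + 2δν L̄ / ((1-R)(μ-r))`. -/
theorem portfolio_upper_bound
    (μ r σ δ R S ν ρ κ η Lbar x : ℝ)
    (hr : 0 < r) (hrμ : r < μ) (hσ : 0 < σ) (hδ : 0 < δ)
    (hS : 0 < S) (hSR : S < R) (hR : R < 1)
    (hν : ν = (1 - R) / (1 - S)) (hν0 : 0 < ν) (hν1 : ν < 1)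
    (hρ : ρ = 1 - 1 / ν)
    (hκ : κ = (μ - r) ^ 2 / (2 * σ ^ 2))
    (hη : η = (1 / S) * (δ + (S - 1) * (r + κ / R))) (hηpos : 0 < η)
    (hLbar : 0 < Lbar) (hx : 0 < x)
    (J J' J'' : ℝ → ℝ)
    (hd1 : HasDerivAt J (J' x) x)
    (hd2 : HasDerivAt J' (J'' x) x)
    (hJpos : 0 < J x) (hJ'pos : 0 < J' x) (hJ''neg : J'' x < 0)
    (hHJB : δ * ν * J x =
      -κ * (J' x) ^ 2 / J'' x +
      S / (1 - S) * ((J' x) ^ (-(1 / S)) * ((1 - R) * J x) ^ (ρ / S)) * J' x +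
      r * x * J' x)
    (hhom : (1 - R) * J x ≤ (x + Lbar) * J' x)
    (hc : η * x ≤ (J' x) ^ (-(1 / S)) * ((1 - R) * J x) ^ (ρ / S)) :
    -((μ - r) / σ ^ 2) * (J' x / J'' x) ≤
      (μ - r) / (R * σ ^ 2) * x + 2 * δ * ν * Lbar / ((1 - R) * (μ - r)) := by
  have hS1 : 0 < 1 - S := by linarith
  have hR1 : 0 < 1 - R := by linarith
  have hR0 : 0 < R := hS.trans hSR
  have hm : 0 < μ - r := by linarith
  have hκ0 : 0 < κ := by rw [hκ]; positivity
  have hSη : S * η = δ - (1 - S) * (r + κ / R) := by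
    rw [hη]; field_simp; ring
  set c := (J' x) ^ (-(1 / S)) * ((1 - R) * J x) ^ (ρ / S)
  have hdiv : δ * ν * (J x / J' x) = κ * (-(J' x / J'' x)) + S / (1 - S) * c + r * x := by
    have hne : J'' x ≠ 0 := hJ''neg.ne
    field_simp at hHJB ⊢
    linear_combination hHJB
  have hratio : δ * ν * (J x / J' x) ≤ δ / (1 - S) * (x + Lbar) := by
    have h : (1 - R) * J x / J' x ≤ x + Lbar := (div_le_iff₀ hJ'pos).2 hhom
    calc δ * ν * (J x / J' x) = δ / (1 - S) * ((1 - R) * J x / J' x) := by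
          rw [hν]; field_simp
      _ ≤ _ := by gcongr
  have hcons : S / (1 - S) * (η * x) ≤ S / (1 - S) * c := by gcongr
  have hSηx : S / (1 - S) * (η * x) = δ / (1 - S) * x - (r + κ / R) * x := by
    rw [show S / (1 - S) * (η * x) = S * η / (1 - S) * x by ring, hSη]
    field_simp
  have hq : κ * (-(J' x / J'' x)) ≤ κ / R * x + δ / (1 - S) * Lbar := by linarith
  have hπ : -((μ - r) / σ ^ 2) * (J' x / J'' x) =
      2 / (μ - r) * (κ * (-(J' x / J'' x))) := by
    rw [hκ]; field_simp
  calc -((μ - r) / σ ^ 2) * (J' x / J'' x)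
      = 2 / (μ - r) * (κ * (-(J' x / J'' x))) := hπ
    _ ≤ 2 / (μ - r) * (κ / R * x + δ / (1 - S) * Lbar) := by gcongr
    _ = _ := by rw [hκ, hν]; field_simp
end

section
/- (Proposition 6.8(ii), deterministic form.) Let $0<r<\mu$, $\sigma>0$, $\delta>0$, $0<S<R<1$, $\nu=(1-R)/(1-S)\in(0,1)$, $\rho=1-1/\nu$, $0<k<\frac{\mu-r}{R\sigma^{2}}$, $\bar L>0$, and $\eta^{0}=\frac{S-1}{S}[k(\mu-r)-\tfrac12\sigma^{2}Rk^{2}+r-\frac{\delta\nu}{1-R}]$. Let $J$ be twice differentiable at $x>0$ with $J(x)>0$, $J'(x)>0$, $J''(x)<0$, satisfying the unconstrained-region equation $\delta\nu J(x)=-\kappa\frac{(J'(x))^{2}}{J''(x)}+\frac{S}{1-S}c^{*}(x)J'(x)+rxJ'(x)$, where $\kappa=(\mu-r)^2/(2\sigma^2)$ and $c^{*}(x)=(J'(x))^{-1/S}((1-R)J(x))^{\rho/S}$. If moreover $xJ'(x)\le(1-R)J(x)$ and $c^{*}(x)\le\eta^{0}x\big(\frac{x+\bar L}{x}\big)^{1/S}$,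 then $\pi^{*}(x)=-\frac{\mu-r}{\sigma^{2}}\frac{J'(x)}{J''(x)}$ satisfies $\pi^{*}(x)\ge kx+\frac{2}{\mu-r}\cdot\frac{S\eta^{0}}{1-S}\,x\left(1-\Big(\frac{x+\bar L}{x}\Big)^{1/S}\right)$. -/
open Real Set

set_option autoImplicit false

/-- Proposition 6.8(ii), deterministic form: lower bound on the feedback
portfolio `π*(x) = -(μ-r)/σ² · J'(x)/J''(x)`:
`π*(x) ≥ kx + (2/(μ-r)) (Sη⁰/(1-S)) x (1 - ((x+L̄)/x)^(1/S))`. -/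
theorem portfolio_lower_bound
    (μ r σ δ R S ν ρ κ k η0 Lbar x : ℝ)
    (hr : 0 < r) (hrμ : r < μ) (hσ : 0 < σ) (hδ : 0 < δ)
    (hS : 0 < S) (hSR : S < R) (hR : R < 1)
    (hν : ν = (1 - R) / (1 - S)) (hν0 : 0 < ν) (hν1 : ν < 1)
    (hρ : ρ = 1 - 1 / ν)
    (hκ : κ = (μ - r) ^ 2 / (2 * σ ^ 2))
    (hk0 : 0 < k) (hk : k < (μ - r) / (R * σ ^ 2))
    (hLbar : 0 < Lbar) (hx : 0 < x)
    (hη0 : η0 = (S - 1) / S *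
      (k * (μ - r) - σ ^ 2 * R * k ^ 2 / 2 + r - δ * ν / (1 - R)))
    (J J' J'' : ℝ → ℝ)
    (hd1 : HasDerivAt J (J' x) x)
    (hd2 : HasDerivAt J' (J'' x) x)
    (hJpos : 0 < J x) (hJ'pos : 0 < J' x) (hJ''neg : J'' x < 0)
    (hHJB : δ * ν * J x =
      -κ * (J' x) ^ 2 / J'' x +
      S / (1 - S) * ((J' x) ^ (-(1 / S)) * ((1 - R) * J x) ^ (ρ / S)) * J' x +
      r * x * J' x)
    (hhom : x * J' x ≤ (1 - R) * J x)
    (hc : (J' x) ^ (-(1 / S)) * ((1 - R) * J x) ^ (ρ / S) ≤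
      η0 * x * ((x + Lbar) / x) ^ (1 / S)) :
    k * x + 2 / (μ - r) * (S * η0 / (1 - S)) * x *
        (1 - ((x + Lbar) / x) ^ (1 / S)) ≤
      -((μ - r) / σ ^ 2) * (J' x / J'' x) := by
  have hm : 0 < μ - r := sub_pos.2 hrμ
  have hR1 : 0 < 1 - R := sub_pos.2 hR
  have hS1 : 0 < 1 - S := by linarith
  have hRσ : 0 < R * σ ^ 2 := mul_pos (hS.trans hSR) (pow_pos hσ 2)
  have hidentity : δ * ν / (1 - R) - r =
      k * (μ - r) - σ ^ 2 * R * k ^ 2 / 2 + S * η0 / (1 - S) := by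
    have h : S * η0 / (1 - S) =
        -(k * (μ - r) - σ ^ 2 * R * k ^ 2 / 2 + r - δ * ν / (1 - R)) := by
      rw [hη0]
      generalize k * (μ - r) - σ ^ 2 * R * k ^ 2 / 2 + r - δ * ν / (1 - R) = A
      field_simp
      ring
    linarith
  have hleverage : k * (μ - r) / 2 ≤ k * (μ - r) - σ ^ 2 * R * k ^ 2 / 2 := by
    have := mul_le_mul_of_nonneg_left ((lt_div_iff₀ hRσ).1 hk).le hk0.le
    linarith
  generalize (J' x) ^ (-(1 / S)) * ((1 - R) * J x) ^ (ρ / S) = c at hHJB hc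
  generalize ((x + Lbar) / x) ^ (1 / S) = E at hc ⊢
  have hdiffusion : -κ * (J' x) ^ 2 / J'' x =
      (μ - r) / 2 * (-((μ - r) / σ ^ 2) * (J' x / J'' x)) * J' x := by
    rw [hκ]
    ring
  rw [hdiffusion] at hHJB
  generalize -((μ - r) / σ ^ 2) * (J' x / J'' x) = p at hHJB ⊢
  have hdiscount : δ * ν / (1 - R) * x * J' x ≤ δ * ν * J x := by
    calc δ * ν / (1 - R) * x * J' x = δ * ν / (1 - R) * (x * J' x) := by ring
      _ ≤ δ * ν / (1 - R) * ((1 - R) * J x) := by gcongr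
      _ = δ * ν * J x := by field_simp
  have hdivided : δ * ν / (1 - R) * x ≤ (μ - r) / 2 * p + S / (1 - S) * c + r * x :=
    le_of_mul_le_mul_right (by linarith) hJ'pos
  have hconsumption : S / (1 - S) * c ≤ S / (1 - S) * (η0 * x * E) := by gcongr
  have hscaled : k * (μ - r) / 2 * x + S * η0 / (1 - S) * x * (1 - E) ≤
      (μ - r) / 2 * p := by
    have h := mul_le_mul_of_nonneg_right hleverage hx.le
    have h' := congrArg (· * x) hidentity
    have h'' : S / (1 - S) * (η0 * x * E) = S * η0 / (1 - S) * x * E := by ring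
    linarith
  refine le_of_mul_le_mul_left (hscaled.trans' (le_of_eq ?_)) (half_pos hm)
  field_simp
end

section
/- (Joint concavity of the aggregator, Case 1 of Proposition 4.2.) Let $1<R<S$, so that $\nu=(1-R)/(1-S)=(R-1)/(S-1)\in(0,1)$ and $\rho=1-1/\nu<0$. Then the Epstein–Zin aggregator $f(c,v)=\frac{c^{1-S}}{1-S}\big((1-R)v\big)^{\rho}$ is jointly concave in $(c,v)$ on the convex domain $\{(c,v):c>0,\ v<0\}$ (equivalently $c>0$ and $(1-R)v>0$). -/
open Real Set

set_option autoImplicit false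

/-- The exponential of a convex function is convex. -/
theorem ConvexOn.real_exp {E : Type*} [AddCommGroup E] [Module ℝ E] {s : Set E} {h : E → ℝ}
    (hh : ConvexOn ℝ s h) : ConvexOn ℝ s (fun x => Real.exp (h x)) :=
  ⟨hh.1, fun _ hx _ hy _ _ ha hb hab =>
    (Real.exp_le_exp.mpr (hh.2 hx hy ha hb hab)).trans
      (convexOn_exp.2 (mem_univ _) (mem_univ _) ha hb hab)⟩

/-- A product of nonpositive powers is jointly convex on the positive quadrant. -/
theorem convexOn_rpow_mul_rpow_of_nonpos {a b : ℝ} (ha : a ≤ 0) (hb : b ≤ 0) :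
    ConvexOn ℝ (Ioi (0 : ℝ) ×ˢ Ioi (0 : ℝ)) (fun p => p.1 ^ a * p.2 ^ b) := by
  have hs : Convex ℝ (Ioi (0 : ℝ) ×ˢ Ioi (0 : ℝ)) := (convex_Ioi 0).prod (convex_Ioi 0)
  have hlog := strictConcaveOn_log_Ioi.concaveOn.neg
  have h₁ := ((hlog.comp_linearMap (LinearMap.fst ℝ ℝ ℝ)).subset
    (fun _ hp => hp.1) hs).smul (neg_nonneg.mpr ha)
  have h₂ := ((hlog.comp_linearMap (LinearMap.snd ℝ ℝ ℝ)).subset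
    (fun _ hp => hp.2) hs).smul (neg_nonneg.mpr hb)
  refine (h₁.add h₂).real_exp.congr fun p hp => ?_
  simp only [Pi.add_apply, Function.comp_apply, Pi.neg_apply, smul_eq_mul, neg_mul_neg,
    LinearMap.fst_apply, LinearMap.snd_apply]
  rw [Real.exp_add, Real.rpow_def_of_pos hp.1, Real.rpow_def_of_pos hp.2, mul_comm a,
    mul_comm b]

/-- joint concavity of the aggregator, Case 1 of Proposition 4.2: for
`1 < R < S` (so `ν = (1-R)/(1-S) ∈ (0,1)` and `ρ = 1 - 1/ν < 0`), the Epstein–Zin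
aggregator `f(c,v) = c^(1-S)/(1-S) ((1-R)v)^ρ` is jointly concave in `(c,v)` on the
convex domain `{(c,v) : c > 0, v < 0}`. -/
theorem aggregator_jointly_concave
    (R S ν ρ : ℝ)
    (hR : 1 < R) (hRS : R < S)
    (hν : ν = (1 - R) / (1 - S))
    (hρ : ρ = 1 - 1 / ν) :
    ConcaveOn ℝ {p : ℝ × ℝ | 0 < p.1 ∧ p.2 < 0}
      (fun p => p.1 ^ (1 - S) / (1 - S) * ((1 - R) * p.2) ^ ρ) := by
  have hρ_nonpos : ρ ≤ 0 := by
    have hν_pos : 0 < ν := hν ▸ div_pos_of_neg_of_neg (by linarith) (by linarith)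
    have hν_le : ν ≤ 1 := by
      rw [hν, div_le_one_of_neg (by linarith)]
      linarith
    rw [hρ, sub_nonpos]
    exact (one_le_div hν_pos).mpr hν_le
  have hdom : Convex ℝ {p : ℝ × ℝ | 0 < p.1 ∧ p.2 < 0} :=
    (convex_Ioi (0 : ℝ)).prod (convex_Iio (0 : ℝ))
  have hconv := ((convexOn_rpow_mul_rpow_of_nonpos (by linarith : 1 - S ≤ 0)
    hρ_nonpos).comp_linearMap (LinearMap.id.prodMap ((1 - R) • LinearMap.id))).subset
    (fun p hp => ⟨hp.1, mul_pos_of_neg_of_neg (by linarith) hp.2⟩) hdom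
  refine (hconv.smul (inv_nonneg.mpr (by linarith : 0 ≤ S - 1))).neg.congr fun p _ => ?_
  simp only [Pi.neg_apply, Function.comp_apply, LinearMap.prodMap_apply, LinearMap.id_apply,
    LinearMap.smul_apply, smul_eq_mul]
  rw [← neg_mul, ← inv_neg, neg_sub]
  ring
end

section
/- (Joint concavity of the transformed generator, Case 2 of Proposition 4.2.) Let $0<R<1$, $0<S<1$, $\rho<0$, $\delta>0$ and $t\ge 0$. Then the function $F(c,\tilde v,\tilde z)=\frac{(1-\rho)(1-R)^{\rho}}{1-S}\,e^{-\delta t}\,c^{1-S}+\frac{\rho}{2(1-\rho)}\cdot\frac{\tilde z^{2}}{\tilde v}$ is jointly concave in $(c,\tilde v,\tilde z)$ on the convex domain $\{(c,\tilde v,\tilde z):c\ge 0,\ \tilde v>0,\ \tilde z\in\mathbb{R}\}$. -/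
open Real Set

set_option autoImplicit false

/-- The quadratic-over-linear function `(v, z) ↦ z² / v` is convex on the half plane `v > 0`. -/
theorem convexOn_sq_div : ConvexOn ℝ {q : ℝ × ℝ | 0 < q.1} (fun q => q.2 ^ 2 / q.1) := by
  refine ⟨(convex_Ioi (0 : ℝ)).linear_preimage (LinearMap.fst ℝ ℝ ℝ), ?_⟩
  rintro ⟨v, x⟩ hv ⟨w, y⟩ hw a b ha hb hab
  simp only [mem_ofPred_eq] at hv hw
  have hpos : 0 < a * v + b * w := (convex_Ioi (0 : ℝ)) hv hw ha hb hab
  obtain ⟨q, rfl⟩ : ∃ q, x = q * v := ⟨x / v, by field_simp⟩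
  obtain ⟨s, rfl⟩ : ∃ s, y = s * w := ⟨y / w, by field_simp⟩
  have hq : (q * v) ^ 2 / v = q ^ 2 * v := by field_simp
  have hs : (s * w) ^ 2 / w = s ^ 2 * w := by field_simp
  simp only [Prod.smul_mk, Prod.mk_add_mk, smul_eq_mul, hq, hs]
  rw [div_le_iff₀ hpos]
  have hnn : 0 ≤ a * b * v * w * (q - s) ^ 2 := by positivity
  linarith

/-- joint concavity of the transformed generator, Case 2 of
Proposition 4.2: for `0 < R < 1`, `0 < S < 1`, `ρ < 0`, `δ > 0`, `t ≥ 0`, the function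
`F(c, ṽ, z̃) = ((1-ρ)(1-R)^ρ/(1-S)) e^(-δt) c^(1-S) + (ρ/(2(1-ρ))) z̃²/ṽ`
is jointly concave on `{(c, ṽ, z̃) : c ≥ 0, ṽ > 0, z̃ ∈ ℝ}`. -/
theorem transformed_generator_concave
    (R S ρ δ t : ℝ)
    (hR0 : 0 < R) (hR1 : R < 1) (hS0 : 0 < S) (hS1 : S < 1)
    (hρ : ρ < 0) (hδ : 0 < δ) (ht : 0 ≤ t) :
    ConcaveOn ℝ {p : ℝ × ℝ × ℝ | 0 ≤ p.1 ∧ 0 < p.2.1}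
      (fun p => (1 - ρ) * (1 - R) ^ ρ / (1 - S) * Real.exp (-(δ * t)) * p.1 ^ (1 - S) +
        ρ / (2 * (1 - ρ)) * (p.2.2 ^ 2 / p.2.1)) := by
  have hset : Convex ℝ {p : ℝ × ℝ × ℝ | 0 ≤ p.1 ∧ 0 < p.2.1} :=
    ((convex_Ici (0 : ℝ)).linear_preimage (LinearMap.fst ℝ ℝ (ℝ × ℝ))).inter
      (convexOn_sq_div.1.linear_preimage (LinearMap.snd ℝ ℝ (ℝ × ℝ)))
  have hA : 0 ≤ (1 - ρ) * (1 - R) ^ ρ / (1 - S) * Real.exp (-(δ * t)) := by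
    have h1 : 0 < 1 - ρ := by linarith
    have h2 : 0 < 1 - R := by linarith
    have h3 : 0 < 1 - S := by linarith
    positivity
  have hB : 0 ≤ -(ρ / (2 * (1 - ρ))) :=
    neg_nonneg.2 (div_nonpos_of_nonpos_of_nonneg hρ.le (by linarith))
  have hpow : ConcaveOn ℝ {p : ℝ × ℝ × ℝ | 0 ≤ p.1 ∧ 0 < p.2.1} (fun p => p.1 ^ (1 - S)) :=
    ((Real.concaveOn_rpow (by linarith) (by linarith)).comp_linearMap
      (LinearMap.fst ℝ ℝ (ℝ × ℝ))).subset (fun _ hp => hp.1) hset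
  have hquad : ConvexOn ℝ {p : ℝ × ℝ × ℝ | 0 ≤ p.1 ∧ 0 < p.2.1}
      (fun p => p.2.2 ^ 2 / p.2.1) :=
    (convexOn_sq_div.comp_linearMap (LinearMap.snd ℝ ℝ (ℝ × ℝ))).subset
      (fun _ hp => hp.2) hset
  refine ((hpow.smul hA).add (hquad.smul hB).neg).congr fun p _ => ?_
  simp only [Pi.add_apply, Pi.neg_apply, smul_eq_mul]
  ring
end

section
/- (Proposition 5.3, uniform interior estimates for the regularized HJB equation.) Let $0<r<\mu$, $\sigma>0$, $\delta>0$, $0<S<R<1$, $\nu=(1-R)/(1-S)\in(0,1)$, $\rho=1-1/\nu$, $\kappa=(\mu-r)^2/(2\sigma^2)$, $\eta=\frac1S[\delta+(S-1)(r+\kappa/R)]>0$, and let $g:[0,\infty)\to[0,\infty)$ be increasing, concave, Lipschitz with $g(x)>0$ for $x>0$. Then for every interval $[x_1,x_2]\subset(0,\infty)$ there exist positive constants $K_1,K_2,K_3$, independent of $\epsilon$, with the following property: for every sufficiently small $\epsilon>0$ (so that $\delta\nu>\tfrac12\epsilon^{2}\sigma^{2}R(1-R)$) and every strictly increasing, strictly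 concave $C^{2}$ function $J:(0,\infty)\to(0,\infty)$ that is four times continuously differentiable on the open set where $-\frac{\mu-r}{\sigma^{2}}\frac{J'}{J''}<g(x)$, solves on $(0,\infty)$ the regularized HJB equation $\delta\nu J(x)=\sup_{|\pi|\le g(x)}\big[\pi(\mu-r)J'(x)+\tfrac12\sigma^{2}(\pi^{2}+\epsilon^{2}x^{2})J''(x)\big]+\sup_{c\ge 0}\big[f(c,J(x))-cJ'(x)\big]+rxJ'(x)$, and satisfies the two-sided growth bound $\big(\delta-\tfrac{1}{2\nu}\sigma^{2}\epsilon^{2}R(1-R)\big)^{-\nu}\frac{(rx)^{1-R}}{1-R}\le J(x)\le\big(\eta+\tfrac{R(1-S)}{2S}\sigma^{2}\epsilon^{2}\big)^{-\nu S}\frac{x^{1-R}}{1-R}$ for all $x>0$, one has $|J''(x)|\le K_1$, $J(x)\in[K_2,K_3]$ and $J'(x)\in[K_2,K_3]$ for all $x\in[x_1,x_2]$. -/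
open Real Set

set_option autoImplicit false

open Filter Topology

/-- The maximal value of the strictly concave quadratic `a t - b t² / 2`, shifted by `k`, over an
interval `|t| ≤ G` containing the critical point `a / b`. -/
theorem sSup_quadratic_of_critical_le {a b G k : ℝ} (ha : 0 ≤ a) (hb : 0 < b) (hG : a / b ≤ G) :
    sSup {y | ∃ t : ℝ, |t| ≤ G ∧ y = a * t - b * t ^ 2 / 2 + k} = a ^ 2 / (2 * b) + k := by
  refine IsGreatest.csSup_eq ⟨⟨a / b, ?_, ?_⟩, ?_⟩
  · rwa [abs_of_nonneg (by positivity)]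
  · field_simp
    ring
  · rintro y ⟨t, -, rfl⟩
    have h : a ^ 2 / (2 * b) - (a * t - b * t ^ 2 / 2) = (a - b * t) ^ 2 / (2 * b) := by
      field_simp
      ring
    have : 0 ≤ (a - b * t) ^ 2 / (2 * b) := by positivity
    linarith

/-- The convex conjugate of the power utility `c ↦ A c ^ (1 - S) / (1 - S)`. -/
theorem sSup_power_utility_sub_linear {S A p : ℝ} (hS : 0 < S) (hS1 : S < 1) (hA : 0 < A)
    (hp : 0 < p) :
    sSup {y | ∃ c : ℝ, 0 ≤ c ∧ y = c ^ (1 - S) / (1 - S) * A - c * p} =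
      S / (1 - S) * A ^ (1 / S) * p ^ (1 - 1 / S) := by
  have h1S : 0 < 1 - S := by linarith
  set c₀ : ℝ := (A / p) ^ (1 / S) with hc₀
  have hc₀pos : 0 < c₀ := by positivity
  have hpow : c₀ ^ (1 - S) * A = c₀ * p := by
    rw [rpow_sub hc₀pos, rpow_one, hc₀, ← rpow_mul (by positivity), one_div_mul_cancel hS.ne',
      rpow_one]
    field_simp
  have hval : c₀ * p = A ^ (1 / S) * p ^ (1 - 1 / S) := by
    rw [hc₀, div_rpow hA.le hp.le, rpow_sub hp, rpow_one]
    ring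
  have hopt : c₀ ^ (1 - S) / (1 - S) * A - c₀ * p = S / (1 - S) * (c₀ * p) := by
    rw [div_mul_eq_mul_div, hpow]
    field_simp
    ring
  rw [mul_assoc, ← hval, ← hopt]
  refine IsGreatest.csSup_eq ⟨⟨c₀, hc₀pos.le, rfl⟩, ?_⟩
  rintro y ⟨c, hc, rfl⟩
  have ht : 0 ≤ c / c₀ := by positivity
  have hbern := rpow_one_add_le_one_add_mul_self (s := c / c₀ - 1) (by linarith) h1S.le
    (by linarith : 1 - S ≤ 1)
  rw [add_sub_cancel, div_rpow hc hc₀pos.le] at hbern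
  have hcpow : 0 < c₀ ^ (1 - S) := by positivity
  have hc' : c ^ (1 - S) ≤ (1 + (1 - S) * (c / c₀ - 1)) * c₀ ^ (1 - S) := by
    rwa [div_le_iff₀ hcpow] at hbern
  have hmul := mul_le_mul_of_nonneg_right hc' hA.le
  rw [mul_assoc _ _ A, hpow] at hmul
  have hexp : (1 + (1 - S) * (c / c₀ - 1)) * (c₀ * p) = S * (c₀ * p) + (1 - S) * (c * p) := by
    field_simp
    ring
  rw [hexp] at hmul
  rw [hopt, div_mul_eq_mul_div, sub_le_iff_le_add, div_le_iff₀ h1S]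
  calc c ^ (1 - S) * A ≤ _ := hmul
    _ = _ := by
      field_simp

/-- If `D q' = -N` near `x₀` with `D > 0`, where
`N` vanishes and is strictly decreasing at `x₀`, then `q` has no local maximum at `x₀`. -/
theorem not_isLocalMax_of_deriv_mul_eq_neg {q D N : ℝ → ℝ} {x₀ N' : ℝ}
    (hq : ∀ᶠ x in 𝓝 x₀, DifferentiableAt ℝ q x) (hD : ∀ᶠ x in 𝓝 x₀, 0 < D x)
    (hN : ∀ᶠ x in 𝓝 x₀, D x * deriv q x = -N x) (hN₀ : N x₀ = 0)
    (hN' : HasDerivAt N N' x₀) (hneg : N' < 0) : ¬ IsLocalMax q x₀ := by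
  intro hmax
  have hslope := (hasDerivAt_iff_tendsto_slope.1 hN').eventually_lt_const hneg
  rw [eventually_nhdsWithin_iff] at hslope
  obtain ⟨b, hb, hball⟩ := Metric.eventually_nhds_iff.1
    (hq.and (hD.and (hN.and (hslope.and hmax))))
  have hx : x₀ < x₀ + b / 2 := by linarith
  have hmem : ∀ y ∈ Icc x₀ (x₀ + b / 2), dist y x₀ < b := fun y hy => by
    rw [Real.dist_eq, abs_lt]
    constructor <;> linarith [hy.1, hy.2]
  obtain ⟨c, hc, hcd⟩ := exists_deriv_eq_slope q hx
    (fun y hy => (hball (hmem y hy)).1.continuousAt.continuousWithinAt)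
    (fun y hy => (hball (hmem y (Ioo_subset_Icc_self hy))).1.differentiableWithinAt)
  obtain ⟨-, hDc, hNc, hsc, -⟩ := hball (hmem c (Ioo_subset_Icc_self hc))
  have hend : q (x₀ + b / 2) ≤ q x₀ := (hball (hmem _ (right_mem_Icc.2 hx.le))).2.2.2.2
  have hderiv : deriv q c ≤ 0 := by
    rw [hcd]
    exact div_nonpos_of_nonpos_of_nonneg (by linarith) (by linarith)
  have hNneg : N c < 0 := by
    have := hsc (by simpa using hc.1.ne')
    rw [slope_def_field, hN₀, sub_zero, div_lt_iff₀ (by linarith [hc.1]), zero_mul] at this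
    exact this
  nlinarith [mul_nonneg hDc.le (neg_nonneg.2 hderiv)]

/-- At a local maximum of `q = -u''`, the reduced regularized HJB equation
`κ p² / q - e x² q + C u ^ m p ^ n + r x p - d u = 0`, with `p = u'`, bounds `q`
independently of `e` and `x₀`. -/
theorem reduced_hjb_localMax_bound {u p q : ℝ → ℝ} {x₀ κ e C m n r d : ℝ}
    (hκ : 0 < κ) (he : 0 ≤ e) (hC : 0 < C) (hm : m < 0) (hd : 0 ≤ d)
    (hu : ∀ᶠ x in 𝓝 x₀, HasDerivAt u (p x) x) (hp : ∀ᶠ x in 𝓝 x₀, HasDerivAt p (-q x) x)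
    (hq : ∀ᶠ x in 𝓝 x₀, DifferentiableAt ℝ q x)
    (hupos : ∀ᶠ x in 𝓝 x₀, 0 < u x) (hppos : ∀ᶠ x in 𝓝 x₀, 0 < p x)
    (hqpos : ∀ᶠ x in 𝓝 x₀, 0 < q x)
    (heq : ∀ᶠ x in 𝓝 x₀, κ * (p x ^ 2 / q x) - e * x ^ 2 * q x + C * (u x ^ m * p x ^ n)
      + r * x * p x - d * u x = 0)
    (hmax : IsLocalMax q x₀) :
    C * (n * (n - 1)) * (u x₀ ^ m * p x₀ ^ (n - 1 - 1)) * q x₀ ≤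
      2 * e + 2 * r + 2 * (C * (m * n) * (u x₀ ^ (m - 1) * p x₀ ^ n)) := by
  by_contra! hlt
  set D : ℝ → ℝ := fun x => κ * p x ^ 2 / q x ^ 2 + e * x ^ 2 with hD
  set N : ℝ → ℝ := fun x => (2 * e * x + C * n * (u x ^ m * p x ^ (n - 1)) + r * x) * q x
    + (2 * κ - r + d) * p x - C * m * (u x ^ (m - 1) * p x ^ n) * p x with hNdef
  have hDpos : ∀ᶠ x in 𝓝 x₀, 0 < D x := by
    filter_upwards [hppos, hqpos] with x h1 h2
    simp only [hD]
    positivity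
  have hDN : ∀ᶠ x in 𝓝 x₀, D x * deriv q x = -N x := by
    filter_upwards [hu, hp, hq, hupos, hppos, hqpos, heq.eventually_nhds]
      with x h1 h2 h3 h4 h5 h6 h7
    have hE := (((((h2.pow 2).div h3.hasDerivAt h6.ne').const_mul κ).sub
      ((((hasDerivAt_id x).pow 2).const_mul e).mul h3.hasDerivAt)).add
      (((h1.rpow_const (p := m) (Or.inl h4.ne')).mul
        (h2.rpow_const (p := n) (Or.inl h5.ne'))).const_mul C)).add
      (((hasDerivAt_id x).const_mul r).mul h2) |>.sub (h1.const_mul d)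
    have h0 := hE.unique ((hasDerivAt_const x (0 : ℝ)).congr_of_eventuallyEq (by
      filter_upwards [h7] with y hy
      simpa using hy))
    simp only [hD, hNdef]
    simp at h0
    field_simp at h0 ⊢
    linear_combination -h0
  have hu₀ := hu.self_of_nhds
  have hp₀ := hp.self_of_nhds
  have hq₀ := hq.self_of_nhds.hasDerivAt
  have hupos₀ := hupos.self_of_nhds
  have hppos₀ := hppos.self_of_nhds
  have hqpos₀ := hqpos.self_of_nhds
  have hq'₀ : deriv q x₀ = 0 := hmax.deriv_eq_zero
  have hN₀ : N x₀ = 0 := by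
    have := hDN.self_of_nhds
    rw [hq'₀] at this
    linarith
  rw [hq'₀] at hq₀
  have hN' := (((((hasDerivAt_id x₀).const_mul (2 * e)).add
      (((hu₀.rpow_const (p := m) (Or.inl hupos₀.ne')).mul
        (hp₀.rpow_const (p := n - 1) (Or.inl hppos₀.ne'))).const_mul (C * n))).add
      ((hasDerivAt_id x₀).const_mul r)).mul hq₀).add (hp₀.const_mul (2 * κ - r + d)) |>.sub
      ((((hu₀.rpow_const (p := m - 1) (Or.inl hupos₀.ne')).mul
        (hp₀.rpow_const (p := n) (Or.inl hppos₀.ne'))).const_mul (C * m)).mul hp₀)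
  refine not_isLocalMax_of_deriv_mul_eq_neg hq hDpos hDN hN₀ hN' ?_ hmax
  have hpn : p x₀ ^ (n - 1) * p x₀ = p x₀ ^ n := by
    rw [← rpow_add_one hppos₀.ne', sub_add_cancel]
  have hA := mul_lt_mul_of_pos_right hlt hqpos₀
  have h1 : 0 < (-m) * (1 - m) * C * u x₀ ^ (m - 1 - 1) * p x₀ ^ n * p x₀ ^ 2 := by
    have : 0 < -m := by linarith
    have : 0 < 1 - m := by linarith
    positivity
  have h2 : 0 < C * (-m) * u x₀ ^ (m - 1) * p x₀ ^ n * q x₀ := by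
    have : 0 < -m := by linarith
    positivity
  have h3 : 0 < κ * q x₀ := by positivity
  have h4 : 0 ≤ d * q x₀ := by positivity
  simp
  rw [← hpn] at hA h1 h2 ⊢
  linarith

/-- A `C⁴` function on an open set has a differentiable second derivative there. -/
theorem ContDiffOn.differentiableAt_second_deriv {f f' f'' : ℝ → ℝ} {V : Set ℝ} (hV : IsOpen V)
    (hf : ContDiffOn ℝ 4 f V) (hf' : ∀ x ∈ V, HasDerivAt f (f' x) x)
    (hf'' : ∀ x ∈ V, HasDerivAt f' (f'' x) x) {x : ℝ} (hx : x ∈ V) :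
    DifferentiableAt ℝ f'' x := by
  have h1 : ContDiffOn ℝ 3 f' V :=
    (hf.deriv_of_isOpen hV (by norm_num)).congr fun y hy => (hf' y hy).deriv.symm
  have h2 : ContDiffOn ℝ 2 f'' V :=
    (h1.deriv_of_isOpen hV (by norm_num)).congr fun y hy => (hf'' y hy).deriv.symm
  exact (h2.contDiffAt (hV.mem_nhds hx)).differentiableAt (by norm_num)

/-- Maximum principle for the reduced regularized HJB equation: if `q = -u''` is at most `K` at the
endpoints of an interval and `K` dominates the bound at interior local maxima, then `q ≤ K`
throughout. -/
theorem reduced_hjb_max_principle {u p q : ℝ → ℝ} {y₁ y₂ κ e C m n r d L M K : ℝ}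
    (hκ : 0 < κ) (he : 0 ≤ e) (hC : 0 < C) (hm : m < 0) (hn : n < 0) (hd : 0 ≤ d)
    (hL : 0 < L) (hK : 0 ≤ K)
    (hu : ∀ x ∈ Ioo y₁ y₂, HasDerivAt u (p x) x) (hp : ∀ x ∈ Ioo y₁ y₂, HasDerivAt p (-q x) x)
    (huLM : ∀ x ∈ Ioo y₁ y₂, u x ∈ Icc L M) (hpLM : ∀ x ∈ Ioo y₁ y₂, p x ∈ Icc L M)
    (hqc : ContinuousOn q (Icc y₁ y₂)) (hq₁ : q y₁ ≤ K) (hq₂ : q y₂ ≤ K)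
    (hq : ∀ x ∈ Ioo y₁ y₂, K < q x → DifferentiableAt ℝ q x)
    (heq : ∀ x ∈ Ioo y₁ y₂, K < q x → κ * (p x ^ 2 / q x) - e * x ^ 2 * q x
      + C * (u x ^ m * p x ^ n) + r * x * p x - d * u x = 0)
    (hKbound : 2 * e + 2 * r + 2 * (C * (m * n) * (L ^ (m - 1) * L ^ n)) ≤
      C * (n * (n - 1)) * (M ^ m * M ^ (n - 1 - 1)) * K) :
    ∀ x ∈ Icc y₁ y₂, q x ≤ K := by
  intro x hx
  obtain ⟨x₀, hx₀, hmax⟩ := isCompact_Icc.exists_isMaxOn ⟨x, hx⟩ hqc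
  refine (hmax hx).trans ?_
  by_contra! hlt
  have hx₀' : x₀ ∈ Ioo y₁ y₂ :=
    ⟨hx₀.1.lt_of_ne fun h => by rw [← h] at hlt; linarith,
      hx₀.2.lt_of_ne fun h => by rw [h] at hlt; linarith⟩
  have hev : ∀ᶠ y in 𝓝 x₀, y ∈ Ioo y₁ y₂ ∧ K < q y :=
    Filter.Eventually.and (isOpen_Ioo.mem_nhds hx₀')
      ((hqc.continuousAt (Icc_mem_nhds hx₀'.1 hx₀'.2)).eventually_const_lt hlt)
  have hbound := reduced_hjb_localMax_bound hκ he hC hm hd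
    (hev.mono fun y hy => hu y hy.1) (hev.mono fun y hy => hp y hy.1)
    (hev.mono fun y hy => hq y hy.1 hy.2)
    (hev.mono fun y hy => hL.trans_le (huLM y hy.1).1)
    (hev.mono fun y hy => hL.trans_le (hpLM y hy.1).1)
    (hev.mono fun y hy => hK.trans_lt hy.2) (hev.mono fun y hy => heq y hy.1 hy.2)
    (hmax.isLocalMax (Icc_mem_nhds hx₀'.1 hx₀'.2))
  obtain ⟨huL, huM⟩ := huLM x₀ hx₀'
  obtain ⟨hpL, hpM⟩ := hpLM x₀ hx₀'
  have hu0 := hL.trans_le huL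
  have hp0 := hL.trans_le hpL
  have hM0 := hu0.trans_le huM
  have hmn : 0 < m * n := mul_pos_of_neg_of_neg hm hn
  have hnn : 0 < n * (n - 1) := mul_pos_of_neg_of_neg hn (by linarith)
  have hlow : C * (n * (n - 1)) * (M ^ m * M ^ (n - 1 - 1)) * K <
      C * (n * (n - 1)) * (u x₀ ^ m * p x₀ ^ (n - 1 - 1)) * q x₀ := by
    refine mul_lt_mul' ?_ hlt hK (by positivity)
    have h1 := rpow_le_rpow_of_nonpos hu0 huM hm.le
    have h2 := rpow_le_rpow_of_nonpos hp0 hpM (by linarith : n - 1 - 1 ≤ 0)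
    gcongr
  have hupp : C * (m * n) * (u x₀ ^ (m - 1) * p x₀ ^ n) ≤
      C * (m * n) * (L ^ (m - 1) * L ^ n) := by
    have h1 := rpow_le_rpow_of_nonpos hL huL (by linarith : m - 1 ≤ 0)
    have h2 := rpow_le_rpow_of_nonpos hL hpL hn.le
    gcongr
  linarith

/-- Uniform bounds on a compact interval for the values and derivatives of concave functions with
two-sided power growth. -/
theorem exists_value_deriv_bounds_of_concave_power_growth {a b θ l h : ℝ} (ha : 0 < a)
    (hab : a ≤ b) (hθ : 0 < θ) (hl : 0 < l) (hh : 0 < h) :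
    ∃ L M : ℝ, 0 < L ∧ 0 < M ∧ ∀ J J' : ℝ → ℝ, ConcaveOn ℝ (Ioi 0) J →
      (∀ x > (0 : ℝ), HasDerivAt J (J' x) x) →
      (∀ x > (0 : ℝ), l * x ^ θ ≤ J x ∧ J x ≤ h * x ^ θ) →
      ∀ x ∈ Icc a b, J x ∈ Icc L M ∧ J' x ∈ Icc L M := by
  have hb : 0 < b := ha.trans_le hab
  obtain ⟨Y, hYb, hY⟩ : ∃ Y, b < Y ∧ h * b ^ θ + 1 ≤ l * Y ^ θ :=
    ((eventually_gt_atTop b).and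
      (((tendsto_rpow_atTop hθ).const_mul_atTop hl).eventually_ge_atTop _)).exists
  have hY0 : 0 < Y := hb.trans hYb
  refine ⟨min (l * a ^ θ) (1 / Y), max (h * b ^ θ) (2 * (h * b ^ θ) / a), by positivity,
    by positivity, fun J J' hJ hJ' hg x hx => ?_⟩
  have hx0 : 0 < x := ha.trans_le hx.1
  have hpos : ∀ y > (0 : ℝ), 0 < J y := fun y hy => lt_of_lt_of_le (by positivity) (hg y hy).1
  have hJx : J x ≤ h * b ^ θ := (hg x hx0).2.trans (by have := hx.2; gcongr)
  have hup := hJ.le_slope_of_hasDerivAt (half_pos hx0) hx0 (half_lt_self hx0) (hJ' x hx0)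
  have hlo := hJ.slope_le_of_hasDerivAt hx0 hY0 (hx.2.trans_lt hYb) (hJ' x hx0)
  rw [slope_def_field] at hup hlo
  refine ⟨⟨?_, ?_⟩, ?_, ?_⟩
  · exact (min_le_left _ _).trans (le_trans (by have := hx.1; gcongr) (hg x hx0).1)
  · exact hJx.trans (le_max_left _ _)
  · refine (min_le_right _ _).trans (le_trans ?_ hlo)
    have := (hg Y hY0).1
    have := hx.2
    gcongr ?_ / ?_ <;> linarith
  · refine (hup.trans ?_).trans (le_max_right _ _)
    have := hpos _ (half_pos hx0)
    have := hx.1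
    rw [show 2 * (h * b ^ θ) / a = h * b ^ θ / (a / 2) by field_simp]
    gcongr ?_ / ?_ <;> linarith

/-- The regularized HJB equation at a point where the portfolio constraint does not bind. -/
theorem regularized_hjb_eq_reduced {μ r σ δ R S ν ρ ε x u p q G : ℝ} (hrμ : r < μ) (hσ : 0 < σ)
    (hS : 0 < S) (hS1 : S < 1) (hR : R < 1) (hu : 0 < u) (hp : 0 < p) (hq : 0 < q)
    (hG : (μ - r) / σ ^ 2 * (p / q) ≤ G)
    (heq : δ * ν * u =
      sSup {y | ∃ pi : ℝ, |pi| ≤ G ∧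
        y = pi * (μ - r) * p + σ ^ 2 * (pi ^ 2 + ε ^ 2 * x ^ 2) * (-q) / 2} +
      sSup {y | ∃ c : ℝ, 0 ≤ c ∧
        y = c ^ (1 - S) / (1 - S) * ((1 - R) * u) ^ ρ - c * p} +
      r * x * p) :
    (μ - r) ^ 2 / (2 * σ ^ 2) * (p ^ 2 / q) - σ ^ 2 * ε ^ 2 / 2 * x ^ 2 * q
      + S / (1 - S) * (1 - R) ^ (ρ * (1 / S)) * (u ^ (ρ * (1 / S)) * p ^ (1 - 1 / S))
      + r * x * p - δ * ν * u = 0 := by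
  have h1R : 0 < 1 - R := by linarith
  have hμr : 0 < μ - r := by linarith
  have hset : {y | ∃ pi : ℝ, |pi| ≤ G ∧
      y = pi * (μ - r) * p + σ ^ 2 * (pi ^ 2 + ε ^ 2 * x ^ 2) * (-q) / 2} =
      {y | ∃ t : ℝ, |t| ≤ G ∧ y = ((μ - r) * p) * t - (σ ^ 2 * q) * t ^ 2 / 2
        + -(σ ^ 2 * ε ^ 2 / 2 * x ^ 2 * q)} := by
    ext y
    refine exists_congr fun t => and_congr_right fun _ => ?_
    rw [show t * (μ - r) * p + σ ^ 2 * (t ^ 2 + ε ^ 2 * x ^ 2) * (-q) / 2 =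
      ((μ - r) * p) * t - (σ ^ 2 * q) * t ^ 2 / 2 + -(σ ^ 2 * ε ^ 2 / 2 * x ^ 2 * q) by ring]
  rw [hset, sSup_quadratic_of_critical_le (by positivity) (by positivity)
      (by rwa [← div_mul_div_comm]),
    sSup_power_utility_sub_linear hS hS1 (by positivity) hp, ← rpow_mul (by positivity),
    mul_rpow h1R.le hu.le] at heq
  rw [heq]
  field_simp
  ring

/-- Proposition 5.3, uniform interior estimates for the regularized HJB
equation: on every compact interval `[x₁,x₂] ⊂ (0,∞)` there are constants
`K₁, K₂, K₃ > 0`, independent of `ε`, bounding `|J''|`, `J` and `J'` for every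
sufficiently small `ε > 0` and every solution `J` of the regularized HJB equation
satisfying the stated regularity and growth bounds. -/
theorem uniform_interior_estimates
    (μ r σ δ R S ν ρ κ η : ℝ) (g : ℝ → ℝ)
    (hr : 0 < r) (hrμ : r < μ) (hσ : 0 < σ) (hδ : 0 < δ)
    (hS : 0 < S) (hSR : S < R) (hR : R < 1)
    (hν : ν = (1 - R) / (1 - S)) (hν0 : 0 < ν) (hν1 : ν < 1)
    (hρ : ρ = 1 - 1 / ν)
    (hκ : κ = (μ - r) ^ 2 / (2 * σ ^ 2))
    (hη : η = (1 / S) * (δ + (S - 1) * (r + κ / R))) (hηpos : 0 < η)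
    (hg0 : ∀ x ≥ (0 : ℝ), 0 ≤ g x) (hgpos : ∀ x > (0 : ℝ), 0 < g x)
    (hgmono : MonotoneOn g (Ici 0)) (hgconc : ConcaveOn ℝ (Ici 0) g)
    (hglip : ∃ K : NNReal, LipschitzOnWith K g (Ici 0)) :
    ∀ x1 x2 : ℝ, 0 < x1 → x1 ≤ x2 →
      ∃ K1 K2 K3 : ℝ, 0 < K1 ∧ 0 < K2 ∧ 0 < K3 ∧
        ∀ ε : ℝ, 0 < ε → ε ^ 2 * σ ^ 2 * R * (1 - R) / 2 < δ * ν →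
        ∀ J J' J'' : ℝ → ℝ,
          (∀ x > (0 : ℝ), 0 < J x) →
          StrictMonoOn J (Ioi 0) →
          StrictConcaveOn ℝ (Ioi 0) J →
          (∀ x > (0 : ℝ), HasDerivAt J (J' x) x) →
          (∀ x > (0 : ℝ), HasDerivAt J' (J'' x) x) →
          ContinuousOn J'' (Ioi 0) →
          ContDiffOn ℝ 4 J
            {x | 0 < x ∧ -((μ - r) / σ ^ 2) * (J' x / J'' x) < g x} →
          (∀ x > (0 : ℝ),
            δ * ν * J x =
              sSup {y | ∃ pi : ℝ, |pi| ≤ g x ∧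
                y = pi * (μ - r) * J' x +
                  σ ^ 2 * (pi ^ 2 + ε ^ 2 * x ^ 2) * J'' x / 2} +
              sSup {y | ∃ c : ℝ, 0 ≤ c ∧
                y = c ^ (1 - S) / (1 - S) * ((1 - R) * J x) ^ ρ - c * J' x} +
              r * x * J' x) →
          (∀ x > (0 : ℝ),
            (δ - σ ^ 2 * ε ^ 2 * R * (1 - R) / (2 * ν)) ^ (-ν) *
                ((r * x) ^ (1 - R) / (1 - R)) ≤ J x ∧
            J x ≤ (η + R * (1 - S) * σ ^ 2 * ε ^ 2 / (2 * S)) ^ (-(ν * S)) *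
                (x ^ (1 - R) / (1 - R))) →
          ∀ x ∈ Icc x1 x2,
            |J'' x| ≤ K1 ∧ J x ∈ Icc K2 K3 ∧ J' x ∈ Icc K2 K3 := by
  intro x1 x2 hx1 hx12
  have hx2 : 0 < x2 := hx1.trans_le hx12
  have hR0 : 0 < R := hS.trans hSR
  have h1R : 0 < 1 - R := by linarith
  have hS1 : S < 1 := by linarith
  have h1S : 0 < 1 - S := by linarith
  have hμr : 0 < μ - r := by linarith
  have hρneg : ρ < 0 := by
    have : 1 < 1 / ν := (one_lt_div hν0).2 hν1
    linarith
  have hm : ρ * (1 / S) < 0 := mul_neg_of_neg_of_pos hρneg (by positivity)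
  have hn : 1 - 1 / S < 0 := by
    have : 1 < 1 / S := (one_lt_div hS).2 hS1
    linarith
  have hC : 0 < S / (1 - S) * (1 - R) ^ (ρ * (1 / S)) := by positivity
  set m : ℝ := ρ * (1 / S) with hmdef
  set n : ℝ := 1 - 1 / S with hndef
  set C : ℝ := S / (1 - S) * (1 - R) ^ m with hCdef
  have hmn : 0 < m * n := mul_pos_of_neg_of_neg hm hn
  have hnn : 0 < n * (n - 1) := mul_pos_of_neg_of_neg hn (by linarith)
  obtain ⟨L, M, hL, hM, hLM⟩ := exists_value_deriv_bounds_of_concave_power_growth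
    (a := x1 / 2) (b := 2 * x2) (θ := 1 - R) (l := δ ^ (-ν) * (r ^ (1 - R) / (1 - R)))
    (h := η ^ (-(ν * S)) / (1 - R)) (by positivity) (by linarith) h1R (by positivity)
    (by positivity)
  have hgx1 : 0 < g (x1 / 2) := hgpos _ (by positivity)
  set a : ℝ := C * (n * (n - 1)) * (M ^ m * M ^ (n - 1 - 1)) with ha
  set B : ℝ := 2 * (δ * ν / (R * (1 - R))) + 2 * r
    + 2 * (C * (m * n) * (L ^ (m - 1) * L ^ n)) with hB
  set Q : ℝ := (μ - r) / σ ^ 2 * M / g (x1 / 2) with hQ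
  have ha0 : 0 < a := by positivity
  have hB0 : 0 < B := by positivity
  have hQ0 : 0 < Q := by positivity
  have hM2 : 0 < 2 * M / x1 := by positivity
  have hBa : 0 < B / a := by positivity
  set K : ℝ := 2 * M / x1 + Q + B / a with hKdef
  have hK : 0 < K := by positivity
  refine ⟨K, L, M, hK, hL, hM, ?_⟩
  intro ε hε hεsmall J J' J'' hJpos _ hJconc hJ' hJ'' hJ''c hJ4 hHJB hgrowth
  have hbox := hLM J J' hJconc.concaveOn hJ' fun x hx => by
    obtain ⟨h1, h2⟩ := hgrowth x hx
    constructor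
    · refine le_trans ?_ h1
      rw [mul_rpow hr.le hx.le, mul_assoc, div_mul_eq_mul_div]
      refine mul_le_mul_of_nonneg_right (rpow_le_rpow_of_nonpos ?_ ?_ (by linarith))
        (by positivity)
      · rw [sub_pos, div_lt_iff₀ (by positivity)]
        linarith
      · have : 0 ≤ σ ^ 2 * ε ^ 2 * R * (1 - R) / (2 * ν) := by positivity
        linarith
    · refine h2.trans ?_
      rw [div_mul_eq_mul_div, ← mul_div_assoc]
      have : 0 ≤ R * (1 - S) * σ ^ 2 * ε ^ 2 / (2 * S) := by positivity
      have := rpow_le_rpow_of_nonpos hηpos (by linarith :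
        η ≤ η + R * (1 - S) * σ ^ 2 * ε ^ 2 / (2 * S)) (z := -(ν * S))
        (by have : 0 < ν * S := by positivity
            linarith)
      gcongr
  have hanti : AntitoneOn J' (Ioi 0) := fun x hx y hy hxy => by
    have := hJconc.concaveOn.antitoneOn_deriv
      (fun z hz => (hJ' z hz).differentiableAt) hx hy hxy
    rwa [(hJ' x hx).deriv, (hJ' y hy).deriv] at this
  have hJ''nonpos : ∀ x > (0 : ℝ), J'' x ≤ 0 := fun x hx => by
    rw [← (hJ'' x hx).deriv, ← derivWithin_of_isOpen isOpen_Ioi hx]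
    exact hanti.derivWithin_nonpos
  have hslope : ∀ c d : ℝ, 0 < c → c < d → ∃ y ∈ Ioo c d, J'' y = (J' d - J' c) / (d - c) :=
    fun c d hc hcd => exists_hasDerivAt_eq_slope J' J'' hcd
      (fun y hy => (hJ'' y (hc.trans_le hy.1)).continuousAt.continuousWithinAt)
      (fun y hy => hJ'' y (hc.trans hy.1))
  have hJ'le : ∀ c d : ℝ, x1 / 2 ≤ c → x1 / 2 ≤ d → c ≤ 2 * x2 → d ≤ 2 * x2 →
      -(J' d - J' c) ≤ M := fun c d hc hd hc' hd' => by
    have h1 := (hbox c ⟨hc, hc'⟩).2.2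
    have h2 := (hbox d ⟨hd, hd'⟩).2.1
    linarith
  obtain ⟨y₁, hy₁, hqy₁⟩ := hslope (x1 / 2) x1 (by positivity) (by linarith)
  obtain ⟨y₂, hy₂, hqy₂⟩ := hslope x2 (2 * x2) hx2 (by linarith)
  have hsub : Icc y₁ y₂ ⊆ Icc (x1 / 2) (2 * x2) := Icc_subset_Icc hy₁.1.le hy₂.2.le
  have hpos : ∀ x ∈ Icc y₁ y₂, 0 < x := fun x hx => (half_pos hx1).trans_le (hsub hx).1
  have hqc : ContinuousOn (fun x => -J'' x) (Icc y₁ y₂) := (hJ''c.mono hpos).neg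
  have hq₁ : -J'' y₁ ≤ K := by
    have h : -J'' y₁ ≤ 2 * M / x1 := by
      rw [hqy₁, ← neg_div, show 2 * M / x1 = M / (x1 - x1 / 2) by field_simp; ring]
      have := hJ'le (x1 / 2) x1 le_rfl (by linarith) (by linarith) (by linarith)
      exact div_le_div_of_nonneg_right this (by linarith)
    linarith
  have hq₂ : -J'' y₂ ≤ K := by
    have h : -J'' y₂ ≤ 2 * M / x1 := by
      rw [hqy₂, ← neg_div]
      have := hJ'le x2 (2 * x2) (by linarith) (by linarith) (by linarith) le_rfl
      exact div_le_div₀ (by positivity) (by linarith) hx1 (by linarith)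
    linarith
  have hslack : ∀ x ∈ Ioo y₁ y₂, K < -J'' x → (μ - r) / σ ^ 2 * (J' x / -J'' x) < g x := by
    intro x hx hKx
    have hx' := hsub (Ioo_subset_Icc_self hx)
    have hx0 := hpos x (Ioo_subset_Icc_self hx)
    have hgx : g (x1 / 2) ≤ g x := hgmono (mem_Ici.2 (by positivity)) hx0.le hx'.1
    have hpM := (hbox x hx').2.2
    have hQx : Q < -J'' x := by linarith
    rw [hQ, div_lt_iff₀ hgx1] at hQx
    rw [← mul_div_assoc, div_lt_iff₀ (hK.trans hKx)]
    calc (μ - r) / σ ^ 2 * J' x ≤ (μ - r) / σ ^ 2 * M := by gcongr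
      _ < -J'' x * g (x1 / 2) := hQx
      _ ≤ -J'' x * g x := mul_le_mul_of_nonneg_left hgx (hK.trans hKx).le
      _ = g x * -J'' x := mul_comm _ _
  have hVopen : IsOpen (Ioo y₁ y₂ ∩ (fun x => -J'' x) ⁻¹' Ioi K) :=
    (hqc.mono Ioo_subset_Icc_self).isOpen_inter_preimage isOpen_Ioo isOpen_Ioi
  have hV : ∀ x ∈ Ioo y₁ y₂ ∩ (fun x => -J'' x) ⁻¹' Ioi K, 0 < x :=
    fun x hx => hpos x (Ioo_subset_Icc_self hx.1)
  have hJ4V := hJ4.mono fun x hx => ⟨hV x hx, by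
    have := hslack x hx.1 hx.2
    rwa [div_neg, mul_neg, ← neg_mul] at this⟩
  have he : σ ^ 2 * ε ^ 2 / 2 ≤ δ * ν / (R * (1 - R)) := by
    rw [le_div_iff₀ (by positivity)]
    linarith
  have hmaxp := reduced_hjb_max_principle (u := J) (p := J') (q := fun x => -J'' x)
    (κ := (μ - r) ^ 2 / (2 * σ ^ 2)) (e := σ ^ 2 * ε ^ 2 / 2) (r := r) (d := δ * ν) (K := K)
    (by positivity) (by positivity) hC hm hn (by positivity) hL hK.le
    (fun x hx => hJ' x (hpos x (Ioo_subset_Icc_self hx)))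
    (fun x hx => by simpa using hJ'' x (hpos x (Ioo_subset_Icc_self hx)))
    (fun x hx => (hbox x (hsub (Ioo_subset_Icc_self hx))).1)
    (fun x hx => (hbox x (hsub (Ioo_subset_Icc_self hx))).2)
    hqc hq₁ hq₂
    (fun x hx hKx => (hJ4V.differentiableAt_second_deriv hVopen (fun y hy => hJ' y (hV y hy))
      (fun y hy => hJ'' y (hV y hy)) ⟨hx, hKx⟩).neg)
    (fun x hx hKx => by
      have hx0 := hpos x (Ioo_subset_Icc_self hx)
      refine regularized_hjb_eq_reduced hrμ hσ hS hS1 hR (hJpos x hx0)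
        (hL.trans_le (hbox x (hsub (Ioo_subset_Icc_self hx))).2.1) (hK.trans hKx)
        (hslack x hx hKx).le ?_
      simpa only [neg_neg] using hHJB x hx0)
    (by
      have h1 : a * (B / a) = B := mul_div_cancel₀ B ha0.ne'
      have h2 : a * (B / a) ≤ a * K := mul_le_mul_of_nonneg_left (by linarith) ha0.le
      linarith)
  intro x hx
  refine ⟨?_, hbox x ⟨by linarith [hx.1], by linarith [hx.2]⟩⟩
  rw [abs_of_nonpos (hJ''nonpos x (hx1.trans_le hx.1))]
  exact hmaxp x ⟨hy₁.2.le.trans hx.1, hx.2.trans hy₂.1.le⟩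
end
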